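/- arXiv:2406.04559 — 5 statements merged into one kernel-verified Lean document; each statement's English description precedes it below -/
import Mathlib

section
/- Let p ≡ 3 (mod 4) be a prime, k an even positive integer, and q = p^k with q > 9. Then for every generator ω of GF(q)*, the Paley graph on GF(q) is not isomorphic to the Peisert graph on GF(q) defined with respect to ω. -/
/-- Paley adjacency on a field: `x ~ y` iff `x ≠ y` and `x - y` is a nonzero square. -/
def paleyAdj {F : Type*} [Field F] (x y : F) : Prop :=
  x ≠ y ∧ ∃ z : F, z ≠ 0 ∧ x - y = z ^ 2

/-- Peisert adjacency on a field with respect to a generator `ω` of `Fˣ`: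
`x ~ y` iff `x - y ∈ ⟨ω⁴⟩ ∪ ω⟨ω⁴⟩`. -/
def peisertAdj {F : Type*} [Field F] (ω : Fˣ) (x y : F) : Prop :=
  x ≠ y ∧ ∃ c : Fˣ, c ∈ Subgroup.zpowers (ω ^ 4) ∧
    (x - y = (c : F) ∨ x - y = (ω : F) * (c : F))

open Polynomial

lemma pp_sum_pow {F : Type*} [Field F] [Fintype F] (n : ℕ) :
    ∑ y : F, y ^ n = if n ≠ 0 ∧ (Fintype.card F - 1) ∣ n then (-1 : F) else 0 := by
  classical
  by_cases hn : n = 0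
  · simp [hn]
  · have h := FiniteField.sum_pow_units F n
    have h2 : ∑ y : F, y ^ n = ∑ x : Fˣ, ((x : F) ^ n) := by
      rw [← Finset.sum_subset (Finset.subset_univ (Finset.univ.erase (0 : F)))]
      · symm
        refine Finset.sum_bij (fun x _ => (x : F)) ?_ ?_ ?_ ?_
        · intro a _; simp
        · intro a _ b _ hab; exact Units.ext hab
        · intro b hb
          simp at hb
          exact ⟨Units.mk0 b hb, by simp, rfl⟩
        · intros; rfl
      · intro x _ hx
        simp at hx
        simp [hx, hn]
    rw [h2, h]
    simp [hn]

lemma pp_sum_eval_zero {F : Type*} [Field F] [Fintype F] (T : F[X])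
    (h : T.natDegree < Fintype.card F - 1) : ∑ y : F, T.eval y = 0 := by
  simp_rw [eval_eq_sum_range]
  rw [Finset.sum_comm]
  refine Finset.sum_eq_zero fun i hi => ?_
  rw [← Finset.mul_sum, FiniteField.sum_pow_lt_card_sub_one, mul_zero]
  simp at hi
  omega

lemma pp_sum_eval_coeff {F : Type*} [Field F] [Fintype F] (T : F[X])
    (h : T.natDegree < Fintype.card F) (l : ℕ) (hl : 1 ≤ l) (hl' : l ≤ Fintype.card F - 1) :
    ∑ y : F, T.eval y * y ^ (Fintype.card F - 1 - l) = - T.coeff l := by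
  simp_rw [eval_eq_sum_range' h, Finset.sum_mul, mul_assoc, ← pow_add]
  rw [Finset.sum_comm]
  simp_rw [← Finset.mul_sum]
  rw [Finset.sum_eq_single l]
  · rw [pp_sum_pow, if_pos]
    · ring
    · have : l + (Fintype.card F - 1 - l) = Fintype.card F - 1 := by omega
      rw [this]
      exact ⟨by omega, dvd_rfl⟩
  · intro b hb hbl
    rw [pp_sum_pow, if_neg, mul_zero]
    rintro ⟨h1, c, hc⟩
    simp at hb
    rcases c with _ | _ | c
    · omega
    · simp at hc; omega
    · have : (Fintype.card F - 1) * (c + 1 + 1) = (Fintype.card F - 1) * c + 2 * (Fintype.card F - 1) := by ring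
      have h3 : 0 ≤ (Fintype.card F - 1) * c := Nat.zero_le _
      omega
  · intro hl2
    simp at hl2
    omega

/-- N_k -/
lemma pp_choose_step (p d : ℕ) [hp : Fact p.Prime] (hd : p = 2 * d + 1) (N δ r : ℕ) (hr : r ≤ d)
    (h : ¬ p ∣ N.choose δ) : ¬ p ∣ (p * N + d).choose (p * δ + r) := by
  have hl := Choose.choose_modEq_choose_mod_mul_choose_div_nat (p := p) (n := p * N + d) (k := p * δ + r)
  have e1 : (p * N + d) % p = d := by rw [Nat.mul_add_mod]; exact Nat.mod_eq_of_lt (by omega)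
  have e2 : (p * δ + r) % p = r := by rw [Nat.mul_add_mod]; exact Nat.mod_eq_of_lt (by omega)
  have e3 : (p * N + d) / p = N := by
    rw [Nat.mul_add_div hp.out.pos, Nat.div_eq_of_lt (by omega)]; rfl
  have e4 : (p * δ + r) / p = δ := by
    rw [Nat.mul_add_div hp.out.pos, Nat.div_eq_of_lt (by omega)]; rfl
  rw [e1, e2, e3, e4] at hl
  rw [hl.dvd_iff dvd_rfl, hp.out.dvd_mul, not_or]
  refine ⟨?_, h⟩
  have := Nat.choose_mul_factorial_mul_factorial hr
  intro hdv
  have : p ∣ d.factorial := by rw [← this, mul_assoc]; exact hdv.mul_right _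
  rw [hp.out.dvd_factorial] at this
  omega

lemma pp_half (p d : ℕ) (hd : p = 2 * d + 1) (k : ℕ) :
    (p ^ (k+1) - 1) / 2 = p * ((p ^ k - 1) / 2) + d := by
  have h : p ^ k % 2 = 1 := by rw [Nat.pow_mod, hd]; simp [Nat.add_mod]
  obtain ⟨c, hc⟩ : ∃ c, p ^ k = 2 * c + 1 := ⟨p ^ k / 2, by omega⟩
  rw [pow_succ, hc]
  have : (2 * c + 1) * p = 2 * (p * c + d) + 1 := by rw [hd]; ring
  rw [this]
  have h2 : (2 * c + 1 - 1) / 2 = c := by omega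
  rw [h2]
  omega

lemma pp_le_of_not_dvd {p N δ : ℕ} (h : ¬ p ∣ N.choose δ) : δ ≤ N := by
  by_contra hc
  rw [Nat.choose_eq_zero_of_lt (by omega)] at h
  simp at h

lemma pp_pow_good (p d : ℕ) [hp : Fact p.Prime] (hd : p = 2 * d + 1) (hd1 : 1 ≤ d) (k i : ℕ) (hi : i < k) :
    ¬ p ∣ ((p ^ k - 1) / 2).choose (p ^ i) := by
  induction k generalizing i with
  | zero => omega
  | succ k ih =>
    rw [pp_half p d hd]
    rcases i with _ | i
    · have := pp_choose_step p d hd ((p ^ k - 1) / 2) 0 1 hd1 (by simpa using hp.out.one_lt.ne')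
      simpa using this
    · have := pp_choose_step p d hd ((p ^ k - 1) / 2) (p ^ i) 0 (by omega) (ih i (by omega))
      simpa [pow_succ'] using this

lemma pp_split (p d : ℕ) [hp : Fact p.Prime] (hd : p = 2 * d + 1) (hd1 : 1 ≤ d) (k l : ℕ)
    (hl : l < p ^ k) (h0 : l ≠ 0) (hpow : ∀ i < k, l ≠ p ^ i) :
    ∃ a b, a ≠ 0 ∧ b ≠ 0 ∧ l = a + b ∧ ¬ p ∣ ((p ^ k - 1) / 2).choose a ∧
      ¬ p ∣ ((p ^ k - 1) / 2).choose b := by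
  induction k generalizing l with
  | zero => simp at hl; omega
  | succ k ih =>
    rw [pp_half p d hd]
    have hp0 := hp.out.pos
    have hdm := Nat.div_add_mod l p
    have hr : l % p < p := Nat.mod_lt _ hp0
    set r := l % p
    set l' := l / p
    have hl' : l' < p ^ k := by
      apply Nat.div_lt_of_lt_mul; rw [← pow_succ']; exact hl
    have hone : ¬ p ∣ ((p ^ k - 1) / 2).choose 0 := by simpa using hp.out.one_lt.ne'
    by_cases hz : l' = 0
    · rw [hz] at hdm
      have h1 : l ≠ 1 := by simpa using hpow 0 (by omega)
      refine ⟨r / 2, r - r / 2, by omega, by omega, by omega, ?_, ?_⟩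
      · simpa using pp_choose_step p d hd _ 0 (r / 2) (by omega) hone
      · simpa using pp_choose_step p d hd _ 0 (r - r / 2) (by omega) hone
    · by_cases hpw : ∃ i < k, l' = p ^ i
      · obtain ⟨i, hi, hi'⟩ := hpw
        have hr0 : r ≠ 0 := by
          intro h
          apply hpow (i + 1) (by omega)
          rw [← hdm, h, hi', pow_succ']; rfl
        refine ⟨p * l' + r / 2, r - r / 2, ?_, by omega, by omega, ?_, ?_⟩
        · have : 0 < p * l' := Nat.mul_pos hp0 (by omega)
          omega
        · exact pp_choose_step p d hd _ l' (r / 2) (by omega) (hi' ▸ pp_pow_good p d hd hd1 k i hi)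
        · simpa using pp_choose_step p d hd _ 0 (r - r / 2) (by omega) hone
      · push Not at hpw
        obtain ⟨a, b, ha, hb, hab, h1, h2⟩ := ih l' hl' hz hpw
        refine ⟨p * a + r / 2, p * b + (r - r / 2), ?_, ?_, ?_, ?_, ?_⟩
        · have : 0 < p * a := Nat.mul_pos hp0 (by omega)
          omega
        · have : 0 < p * b := Nat.mul_pos hp0 (by omega)
          omega
        · have : p * l' = p * a + p * b := by rw [hab]; ring
          omega
        · exact pp_choose_step p d hd _ _ _ (by omega) h1
        · exact pp_choose_step p d hd _ _ _ (by omega) h2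

lemma pp_choose_mul (p : ℕ) [hp : Fact p.Prime] (n c : ℕ) :
    p ∣ n.choose (p * c) ↔ p ∣ (n / p).choose c := by
  have hl := Choose.choose_modEq_choose_mod_mul_choose_div_nat (p := p) (n := n) (k := p * c)
  rw [Nat.mul_mod_right, Nat.mul_div_cancel_left _ hp.out.pos, Nat.choose_zero_right, one_mul] at hl
  exact hl.dvd_iff dvd_rfl

lemma pp_bad (p d : ℕ) [hp : Fact p.Prime] (hd : p = 2 * d + 1) (k i : ℕ) (hi : i < k) :
    p ∣ ((p ^ k - 1) / 2).choose ((d + 1) * p ^ i) := by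
  have hd1 : 1 ≤ d := by have := hp.out.two_le; omega
  induction k generalizing i with
  | zero => omega
  | succ k ih =>
    rw [pp_half p d hd]
    have e1 : (p * ((p ^ k - 1) / 2) + d) % p = d := by
      rw [Nat.mul_add_mod]; exact Nat.mod_eq_of_lt (by omega)
    have e3 : (p * ((p ^ k - 1) / 2) + d) / p = (p ^ k - 1) / 2 := by
      rw [Nat.mul_add_div hp.out.pos, Nat.div_eq_of_lt (by omega : d < p), add_zero]
    rcases i with _ | i
    · have hl := Choose.choose_modEq_choose_mod_mul_choose_div_nat (p := p)
        (n := p * ((p ^ k - 1) / 2) + d) (k := d + 1)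
      rw [e1, Nat.mod_eq_of_lt (by omega : d + 1 < p), Nat.choose_succ_self, zero_mul] at hl
      simpa using (Nat.modEq_zero_iff_dvd).1 hl
    · have : (d + 1) * p ^ (i + 1) = p * ((d + 1) * p ^ i) := by rw [pow_succ]; ring
      rw [this, pp_choose_mul, e3]
      exact ih i (by omega)

lemma pp_coeff_sub {F : Type*} [Field F] (r : F) (n k : ℕ) :
    ((X - C r) ^ n : F[X]).coeff k = (-r) ^ (n - k) * (n.choose k : F) := by
  rw [sub_eq_add_neg, ← C_neg, coeff_X_add_C_pow]

lemma pp_extract {F : Type*} [Field F] [Fintype F] (n j : ℕ) (hj : j < n) (hn : n < Fintype.card F)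
    (y : F) :
    ∑ x : F, (x - y) ^ n * x ^ (Fintype.card F - 1 - (n - j)) = - ((-y) ^ j * (n.choose j : F)) := by
  have h := pp_sum_eval_coeff ((X - C y) ^ n) (by rw [natDegree_pow, natDegree_X_sub_C]; omega)
    (n - j) (by omega) (by omega)
  rw [pp_coeff_sub] at h
  simp only [eval_pow, eval_sub, eval_X, eval_C] at h
  rw [h, Nat.sub_sub_self hj.le, Nat.choose_symm hj.le]

lemma pp_natDegree_diff {F : Type*} [Field F] (n : ℕ) (hn : 0 < n) (x x' : F) :
    ((X - C x) ^ n - (X - C x') ^ n : F[X]).natDegree ≤ n - 1 := by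
  rw [natDegree_le_iff_coeff_eq_zero]
  intro N hN
  rw [coeff_sub, pp_coeff_sub, pp_coeff_sub]
  rcases Nat.lt_or_ge n N with h | h
  · simp [Nat.choose_eq_zero_of_lt h]
  · have : N = n := by omega
    subst this; simp

lemma pp_frob {F : Type*} [Field F] [Fintype F] (p m t : ℕ) (hp : p = 4 * t + 3)
    (hm : 0 < m) (hq : Fintype.card F = 4 * m + 1) (z : F) : (z ^ m) ^ p = z ^ (3 * m) := by
  by_cases hz : z = 0
  · subst hz
    rw [zero_pow hm.ne', zero_pow (by omega), zero_pow (by omega)]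
  · have h := FiniteField.pow_card_sub_one_eq_one z hz
    rw [hq, Nat.add_sub_cancel] at h
    rw [← pow_mul, show m * p = 3 * m + 4 * m * t by rw [hp]; ring, pow_add, pow_mul z (4 * m), h]
    simp

/-- the Peisert sign function -/
def ppPsi {F : Type*} [Field F] (p m : ℕ) (a b : F) (z : F) : F := a * z ^ m + b * (z ^ m) ^ p

lemma pp_Lpei {F : Type*} [Field F] [Fintype F] (p m t k : ℕ) [hpf : Fact p.Prime] [CharP F p]
    (hp : p = 4 * t + 3) (hm : 0 < m) (hq : Fintype.card F = 4 * m + 1)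
    (hqk : Fintype.card F = p ^ k) (hk : 2 ≤ k) (a b x1 x2 x3 x4 : F) :
    ∑ y : F, y * ((ppPsi p m a b (y - x1) - ppPsi p m a b (y - x2)) *
      (ppPsi p m a b (y - x3) - ppPsi p m a b (y - x4))) = 0 := by
  set U : F[X] := (X - C x1) ^ m - (X - C x2) ^ m with hU
  set V : F[X] := (X - C x3) ^ m - (X - C x4) ^ m with hV
  set U' : F[X] := (X - C x1) ^ (3 * m) - (X - C x2) ^ (3 * m) with hU'
  set V' : F[X] := (X - C x3) ^ (3 * m) - (X - C x4) ^ (3 * m) with hV'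
  have dU : U.natDegree ≤ m - 1 := pp_natDegree_diff m hm _ _
  have dV : V.natDegree ≤ m - 1 := pp_natDegree_diff m hm _ _
  have dU' : U'.natDegree ≤ 3 * m - 1 := pp_natDegree_diff (3 * m) (by omega) _ _
  have dV' : V'.natDegree ≤ 3 * m - 1 := pp_natDegree_diff (3 * m) (by omega) _ _
  have eU : ∀ y, U'.eval y = (U.eval y) ^ p := by
    intro y
    simp only [hU, hU', eval_sub, eval_pow, eval_X, eval_C]
    rw [sub_pow_char (p := p), pp_frob p m t hp hm hq, pp_frob p m t hp hm hq]
  have eV : ∀ y, V'.eval y = (V.eval y) ^ p := by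
    intro y
    simp only [hV, hV', eval_sub, eval_pow, eval_X, eval_C]
    rw [sub_pow_char (p := p), pp_frob p m t hp hm hq, pp_frob p m t hp hm hq]
  have key : ∀ y, y * ((ppPsi p m a b (y - x1) - ppPsi p m a b (y - x2)) *
      (ppPsi p m a b (y - x3) - ppPsi p m a b (y - x4))) =
      a * a * (X * (U * V)).eval y + a * b * (X * (U * V')).eval y
      + a * b * (X * (U' * V)).eval y
      + b * b * ((X ^ (p ^ (k - 1)) * (U * V)).eval y) ^ p := by
    intro y
    have hy : (y ^ (p ^ (k - 1))) ^ p = y := by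
      rw [← pow_mul, ← pow_succ, Nat.sub_add_cancel (by omega), ← hqk, FiniteField.pow_card]
    simp only [eval_mul, eval_X, eval_pow, mul_pow, hy, ← eU, ← eV]
    simp only [hU, hV, hU', hV', ppPsi, eval_sub, eval_pow, eval_X, eval_C,
      pp_frob p m t hp hm hq]
    ring
  simp_rw [key]
  have hpk : 3 * p ^ (k - 1) ≤ 4 * m + 1 := by
    rw [← hq, hqk]
    obtain ⟨k', rfl⟩ : ∃ k', k = k' + 1 := ⟨k - 1, by omega⟩
    simp only [Nat.add_sub_cancel, pow_succ']
    exact Nat.mul_le_mul_right _ (by omega)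
  have hpk1 : 3 ≤ p ^ (k - 1) := by
    calc 3 ≤ p := by omega
      _ = p ^ 1 := by simp
      _ ≤ _ := Nat.pow_le_pow_right hpf.out.pos (by omega)
  simp only [Finset.sum_add_distrib, ← Finset.mul_sum]
  rw [← sum_pow_char p]
  have dm : ∀ A B : F[X], (X * (A * B)).natDegree ≤ 1 + (A.natDegree + B.natDegree) := by
    intro A B
    refine natDegree_mul_le.trans ?_
    rw [natDegree_X]
    exact Nat.add_le_add_left natDegree_mul_le _
  rw [pp_sum_eval_zero, pp_sum_eval_zero, pp_sum_eval_zero, pp_sum_eval_zero]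
  · simp [hpf.out.ne_zero]
  · refine lt_of_le_of_lt natDegree_mul_le ?_
    have := natDegree_mul_le (p := U) (q := V)
    rw [natDegree_X_pow]
    omega
  · have := dm U' V
    omega
  · have := dm U V'
    omega
  · have := dm U V
    omega

/-- linearization -/
lemma pp_lin {F : Type*} [Field F] [Fintype F] (p m t k : ℕ) [hpf : Fact p.Prime] [CharP F p]
    (hp : p = 4 * t + 3) (hm : 0 < m) (hq : Fintype.card F = 4 * m + 1)
    (hqk : Fintype.card F = p ^ k) (P : F[X]) (hP : P.natDegree < Fintype.card F)
    (hP0 : P.eval 0 = 0)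
    (hL : ∀ x1 x2 x3 x4 : F, ∑ y : F, P.eval y * (((y - x1) ^ (2 * m) - (y - x2) ^ (2 * m)) *
      ((y - x3) ^ (2 * m) - (y - x4) ^ (2 * m))) = 0) (l : ℕ) (hl : P.coeff l ≠ 0) :
    ∃ i < k, l = p ^ i := by
  by_contra hcon
  push Not at hcon
  have hl0 : l ≠ 0 := by
    rintro rfl
    exact hl (by rw [coeff_zero_eq_eval_zero, hP0])
  have hlq : l < Fintype.card F := by
    refine lt_of_le_of_lt (le_natDegree_of_ne_zero hl) hP
  have hN : (p ^ k - 1) / 2 = 2 * m := by rw [← hqk, hq]; omega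
  obtain ⟨δ, ε, hδ, hε, hsum, h1, h2⟩ := pp_split p (2 * t + 1) (by omega) (by omega) k l
    (hqk ▸ hlq) hl0 hcon
  rw [hN] at h1 h2
  have hδN := pp_le_of_not_dvd h1
  have hεN := pp_le_of_not_dvd h2
  have ex : ∀ j, j < 2 * m → ∀ y : F, ∑ x : F, x ^ (2 * m + j) * ((y - x) ^ (2 * m) - (y - 0) ^ (2 * m))
      = - ((-y) ^ j * ((2 * m).choose j : F)) := by
    intro j hj y
    rw [← pp_extract (2 * m) j hj (by omega) y, show Fintype.card F - 1 - (2 * m - j) = 2 * m + j by omega]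
    simp_rw [mul_sub]
    rw [Finset.sum_sub_distrib, ← Finset.sum_mul, FiniteField.sum_pow_lt_card_sub_one F _ (by omega),
      zero_mul, sub_zero]
    refine Finset.sum_congr rfl fun x _ => ?_
    rw [mul_comm, ← neg_sub x y, Even.neg_pow ⟨m, by ring⟩]
  have tot : ∑ y : F, P.eval y * ((∑ x : F, x ^ (2 * m + (2 * m - δ)) * ((y - x) ^ (2 * m) - (y - 0) ^ (2 * m))) *
      (∑ x : F, x ^ (2 * m + (2 * m - ε)) * ((y - x) ^ (2 * m) - (y - 0) ^ (2 * m)))) = 0 := by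
    simp_rw [Finset.sum_mul_sum, Finset.mul_sum]
    rw [Finset.sum_comm]
    refine Finset.sum_eq_zero fun x _ => ?_
    rw [Finset.sum_comm]
    refine Finset.sum_eq_zero fun x' _ => ?_
    have := hL x 0 x' 0
    refine Eq.trans ?_ ((congrArg (fun u => (x ^ (2 * m + (2 * m - δ)) * x' ^ (2 * m + (2 * m - ε))) * u) this).trans (mul_zero _))
    rw [Finset.mul_sum]
    refine Finset.sum_congr rfl fun y _ => ?_
    ring
  simp_rw [ex (2 * m - δ) (by omega), ex (2 * m - ε) (by omega)] at tot
  have hc := pp_sum_eval_coeff P hP l (by omega) (by omega)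
  have hs : Fintype.card F - 1 - l = (2 * m - δ) + (2 * m - ε) := by omega
  rw [hs] at hc
  set c1 : F := ((2 * m).choose (2 * m - δ) : F) with hc1
  set c2 : F := ((2 * m).choose (2 * m - ε) : F) with hc2
  have hc10 : c1 ≠ 0 := by
    rw [hc1, Nat.choose_symm hδN, Ne, CharP.cast_eq_zero_iff F p]; exact h1
  have hc20 : c2 ≠ 0 := by
    rw [hc2, Nat.choose_symm hεN, Ne, CharP.cast_eq_zero_iff F p]; exact h2
  have : ∀ y : F, P.eval y * (-((-y) ^ (2 * m - δ) * c1) * -((-y) ^ (2 * m - ε) * c2)) =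
      (c1 * c2 * (-1) ^ ((2 * m - δ) + (2 * m - ε))) * (P.eval y * y ^ ((2 * m - δ) + (2 * m - ε))) := by
    intro y
    rw [neg_pow y, neg_pow y (2 * m - ε)]
    ring
  simp_rw [this] at tot
  rw [← Finset.mul_sum, hc] at tot
  simp [hc10, hc20, hl] at tot

lemma pp_paley_coeff {F : Type*} [Field F] [Fintype F] (p m : ℕ) [CharP F p]
    (hq : Fintype.card F = 4 * m + 1) (T : F[X]) (hT : T.natDegree < Fintype.card F) (w : F → F)
    (h : ∀ y, T.eval y = ∑ x : F, w x * (y - x) ^ (2 * m)) (j : ℕ) (hj : p ∣ (2 * m).choose j) :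
    T.coeff j = 0 := by
  have hTe : T = ∑ x : F, C (w x) * (X - C x) ^ (2 * m) := by
    refine eq_of_natDegree_lt_card_of_eval_eq T _ Function.injective_id ?_ ?_
    · intro y
      simp [h, eval_finsetSum]
    · refine max_lt hT ?_
      refine lt_of_le_of_lt (natDegree_sum_le_of_forall_le (n := 2 * m) _ _ fun x _ => ?_) (by omega)
      refine (natDegree_C_mul_le _ _).trans ?_
      rw [natDegree_pow, natDegree_X_sub_C, mul_one]
  rw [hTe, finsetSum_coeff]
  refine Finset.sum_eq_zero fun x _ => ?_
  rw [coeff_C_mul, pp_coeff_sub, (CharP.cast_eq_zero_iff F p _).2 hj, mul_zero, mul_zero]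

lemma pp_pei_mem {F : Type*} [Field F] [Fintype F] (p m : ℕ) [hpf : Fact p.Prime] [CharP F p]
    (hq : Fintype.card F = 4 * m + 1) (hme : Even m) (a b : F) (ha : a ≠ 0) (j s : ℕ) (hj : j < m)
    (hC : ¬ p ∣ m.choose j) (hs : s + m < 4 * m) (hx : ∀ x : F, x ^ (3 * m + j) = (x ^ s) ^ p) :
    ∃ w : F → F, ∀ y, y ^ j = ∑ x : F, w x * ppPsi p m a b (y - x) := by
  have hC' : (m.choose j : F) ≠ 0 := by rw [Ne, CharP.cast_eq_zero_iff F p]; exact hC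
  have key : ∀ y : F, ∑ x : F, x ^ (3 * m + j) * ppPsi p m a b (y - x) =
      a * (- ((-y) ^ j * (m.choose j : F))) := by
    intro y
    rw [← pp_extract m j hj (by omega) y, show Fintype.card F - 1 - (m - j) = 3 * m + j by omega]
    have h0 : (∑ x : F, (X ^ s * (X - C y) ^ m : F[X]).eval x) = 0 := by
      apply pp_sum_eval_zero
      refine lt_of_le_of_lt natDegree_mul_le ?_
      rw [natDegree_X_pow, natDegree_pow, natDegree_X_sub_C]
      omega
    have h1 : ∑ x : F, x ^ (3 * m + j) * ppPsi p m a b (y - x) =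
        a * (∑ x : F, (x - y) ^ m * x ^ (3 * m + j)) +
        b * (∑ x : F, (X ^ s * (X - C y) ^ m : F[X]).eval x) ^ p := by
      rw [sum_pow_char p, Finset.mul_sum, Finset.mul_sum, ← Finset.sum_add_distrib]
      refine Finset.sum_congr rfl fun x _ => ?_
      simp only [eval_mul, eval_pow, eval_X, eval_sub, eval_C, mul_pow, ← hx, ppPsi]
      rw [← neg_sub x y, hme.neg_pow]
      ring
    rw [h1, h0, zero_pow hpf.out.ne_zero, mul_zero, add_zero]
  have hu : a * (-((-1) ^ j * (m.choose j : F))) ≠ 0 := by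
    simp [ha, hC']
  refine ⟨fun x => (a * (-((-1) ^ j * (m.choose j : F))))⁻¹ * x ^ (3 * m + j), fun y => ?_⟩
  simp_rw [mul_assoc _ (_ ^ (3 * m + j)) (ppPsi _ _ _ _ _)]
  rw [← Finset.mul_sum, key, eq_inv_mul_iff_mul_eq₀ hu, neg_pow y]
  ring

lemma pp_transfer {F : Type*} [Field F] [Fintype F] (p m : ℕ) (a b : F) (g : F ≃ F)
    (hg : ∀ x y, (y - x) ^ (2 * m) = ppPsi p m a b (g y - g x)) (j : ℕ)
    (h : ∃ w : F → F, ∀ y, y ^ j = ∑ x : F, w x * ppPsi p m a b (y - x)) :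
    ∃ w : F → F, ∀ y, (g y) ^ j = ∑ x : F, w x * (y - x) ^ (2 * m) := by
  obtain ⟨w, hw⟩ := h
  refine ⟨fun x => w (g x), fun y => ?_⟩
  rw [hw, ← Equiv.sum_comp g]
  simp_rw [hg]

/-- Case `k ≥ 4`. -/
lemma pp_caseA {F : Type*} [Field F] [Fintype F] (p m t k : ℕ) [hpf : Fact p.Prime] [CharP F p]
    (hp : p = 4 * t + 3) (hm : 0 < m) (hme : Even m) (hq : Fintype.card F = 4 * m + 1)
    (hqk : Fintype.card F = p ^ k) (hk : 4 ≤ k) (hke : Even k) (a b : F) (ha : a ≠ 0)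
    (hpsi : ∀ z, ppPsi p m a b z ^ p = ppPsi p m a b z) (g : F ≃ F)
    (hg : ∀ x y, (y - x) ^ (2 * m) = ppPsi p m a b (g y - g x))
    (P : F[X]) (hPd : P.natDegree < Fintype.card F) (hPg : ∀ y, P.eval y = g y)
    (hlin : ∀ l, P.coeff l ≠ 0 → ∃ i < k, l = p ^ i) : False := by
  have hp0 := hpf.out.pos
  have hpsi' : ∀ n z, ppPsi p m a b z ^ (p ^ n) = ppPsi p m a b z := by
    intro n z
    induction n with
    | zero => simp
    | succ n ih => rw [pow_succ, pow_mul, ih, hpsi]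
  -- numerics: write `4 m + 1 = p ^ 2 * (4 m' + 1)`
  obtain ⟨k2, hk2⟩ : ∃ k2, k = k2 + 2 := ⟨k - 2, by omega⟩
  obtain ⟨k3, hk3⟩ : ∃ k3, k2 = 2 * (k3 + 1) := by
    obtain ⟨c, hc⟩ := hke
    exact ⟨c - 2, by omega⟩
  -- p^2 = 4 u + 1
  have hp2 : p ^ 2 = 4 * (4 * t ^ 2 + 6 * t + 2) + 1 := by rw [hp]; ring
  obtain ⟨v, hv⟩ : ∃ v, p ^ (2 * k3) = 4 * v + 1 := by
    rw [pow_mul, hp2]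
    have : (4 * (4 * t ^ 2 + 6 * t + 2) + 1) ^ k3 % 4 = 1 := by
      rw [Nat.pow_mod]; simp [Nat.add_mod]
    exact ⟨(4 * (4 * t ^ 2 + 6 * t + 2) + 1) ^ k3 / 4, by omega⟩
  -- m2 = m / p^2
  set m2 := p * (p * v + t) + (3 * t + 2) with hm2
  have hm2' : p ^ k2 = 4 * m2 + 1 := by
    rw [hk3, mul_add, pow_add, hv, hm2, hp]; ring
  have hmm : m = p * (p * m2 + t) + (3 * t + 2) := by
    have : 4 * m + 1 = 4 * (p * (p * m2 + t) + (3 * t + 2)) + 1 := by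
      rw [← hq, hqk, hk2, pow_add, hm2', hp]; ring
    omega
  have d1 : m / p = p * m2 + t := by
    rw [hmm, Nat.mul_add_div hp0, Nat.div_eq_of_lt (by omega : 3 * t + 2 < p), add_zero]
  have d2 : (p * m2 + t) / p = m2 := by
    rw [Nat.mul_add_div hp0, Nat.div_eq_of_lt (by omega : t < p), add_zero]
  have hC : ¬ p ∣ m.choose (p * (p * (2 * t + 2))) := by
    rw [pp_choose_mul, d1, pp_choose_mul, d2]
    have hl := Choose.choose_modEq_choose_mod_mul_choose_div_nat (p := p) (n := m2) (k := 2 * t + 2)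
    have e1 : m2 % p = 3 * t + 2 := by
      rw [hm2, Nat.mul_add_mod]; exact Nat.mod_eq_of_lt (by omega)
    rw [e1, Nat.mod_eq_of_lt (by omega : 2 * t + 2 < p), Nat.div_eq_of_lt (by omega : 2 * t + 2 < p),
      Nat.choose_zero_right, mul_one] at hl
    rw [hl.dvd_iff dvd_rfl]
    intro hdv
    have h3 := Nat.choose_mul_factorial_mul_factorial (by omega : 2 * t + 2 ≤ 3 * t + 2)
    have : p ∣ (3 * t + 2).factorial := by rw [← h3, mul_assoc]; exact hdv.mul_right _
    rw [hpf.out.dvd_factorial] at this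
    omega
  have hm2lb : p * t + (3 * t + 2) ≤ m2 := by
    rw [hm2]
    have : p * t ≤ p * (p * v + t) := Nat.mul_le_mul_left _ (by omega)
    omega
  have hjm : p * (p * (2 * t + 2)) < m := by
    rw [hmm]
    have : p * (p * (2 * t + 2)) ≤ p * (p * m2 + t) := by
      refine Nat.mul_le_mul_left _ (le_trans (Nat.mul_le_mul_left _ ?_) (Nat.le_add_right _ _))
      omega
    omega
  have hmem0 : ∃ w : F → F, ∀ y, y ^ (p * (p * (2 * t + 2))) = ∑ x : F, w x * ppPsi p m a b (y - x) := by
    refine pp_pei_mem p m hq hme a b ha _ (m + p * (2 * t + 2)) hjm hC ?_ ?_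
    · have : p * (2 * t + 2) ≤ p * (p * (2 * t + 2)) :=
        Nat.mul_le_mul_left _ (Nat.le_mul_of_pos_left _ hp0)
      omega
    · intro x
      rw [pow_add, pow_add, mul_pow, pp_frob p m t hp hm hq, ← pow_mul x, mul_comm _ p]
  have hmem : ∃ w : F → F, ∀ y, y ^ (2 * t + 2) = ∑ x : F, w x * ppPsi p m a b (y - x) := by
    obtain ⟨w, hw⟩ := hmem0
    refine ⟨fun x => w x ^ (p ^ k2), fun y => ?_⟩
    have h1 := congrArg (fun z => z ^ (p ^ k2)) (hw y)
    rw [sum_pow_char_pow p] at h1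
    simp_rw [mul_pow, hpsi'] at h1
    rw [← h1, ← pow_mul, show p * (p * (2 * t + 2)) * p ^ k2 = p ^ k * (2 * t + 2) by
      rw [hk2, pow_add]; ring, pow_mul, ← hqk, FiniteField.pow_card]
  obtain ⟨w, hw⟩ := pp_transfer p m a b g hg _ hmem
  have hP0 : P ≠ 0 := by
    rintro rfl
    have h1 := hPg 0
    have h2 := hPg 1
    simp only [eval_zero] at h1 h2
    exact zero_ne_one (g.injective (h1.symm.trans h2))
  obtain ⟨i, hi, hdeg⟩ := hlin P.natDegree (by simpa using hP0)
  have hdT : (P ^ (2 * t + 2)).natDegree = (2 * t + 2) * p ^ i := by rw [natDegree_pow, hdeg]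
  have hN : (p ^ k - 1) / 2 = 2 * m := by rw [← hqk, hq]; omega
  have := pp_paley_coeff p m hq (P ^ (2 * t + 2)) ?_ w ?_ ((2 * t + 2) * p ^ i) ?_
  · rw [← hdT, coeff_natDegree, leadingCoeff_eq_zero] at this
    exact hP0 (pow_eq_zero_iff (by omega) |>.1 this)
  · rw [hdT, hqk]
    calc (2 * t + 2) * p ^ i < p * p ^ i := Nat.mul_lt_mul_of_pos_right (by omega) (pow_pos hp0 _)
      _ = p ^ (i + 1) := by rw [pow_succ']
      _ ≤ _ := Nat.pow_le_pow_right hp0 (by omega)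
  · intro y
    rw [eval_pow, hPg, hw]
  · rw [← hN]
    exact pp_bad p (2 * t + 1) (by omega) k i hi

/-- Case `k = 2`, `p > 3`. -/
lemma pp_caseB {F : Type*} [Field F] [Fintype F] (p m t : ℕ) [hpf : Fact p.Prime] [CharP F p]
    (hp : p = 4 * t + 3) (ht : 1 ≤ t) (hm : 0 < m) (hme : Even m)
    (hq : Fintype.card F = 4 * m + 1)
    (hqk : Fintype.card F = p ^ 2) (a b : F) (ha : a ≠ 0) (g : F ≃ F)
    (hg : ∀ x y, (y - x) ^ (2 * m) = ppPsi p m a b (g y - g x))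
    (P : F[X]) (hPd : P.natDegree < Fintype.card F) (hPg : ∀ y, P.eval y = g y)
    (hlin : ∀ l, P.coeff l ≠ 0 → ∃ i < 2, l = p ^ i) :
    ∃ c : F, (∀ y, g y = c * y) ∨ (∀ y, g y = c * y ^ p) := by
  have hp0 := hpf.out.pos
  have hmm : m = p * t + (3 * t + 2) := by
    have : 4 * m + 1 = 4 * (p * t + (3 * t + 2)) + 1 := by
      rw [← hq, hqk, hp]; ring
    omega
  set α := P.coeff 1 with hα
  set β := P.coeff p with hβ
  have hPe : P = C α * X + C β * X ^ p := by
    ext l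
    rw [coeff_add, coeff_C_mul, coeff_C_mul_X_pow, coeff_X]
    by_cases h1 : l = 1
    · subst h1
      rw [if_pos rfl, if_neg (by omega), mul_one, add_zero]
    · by_cases h2 : l = p
      · rw [if_neg (by omega), if_pos h2, h2]; simp [hβ]
      · rw [if_neg (by omega), if_neg h2, mul_zero, add_zero]
        by_contra h3
        obtain ⟨i, hi, hl⟩ := hlin l h3
        interval_cases i
        · simp at hl; omega
        · simp at hl; omega
  have hge : ∀ y, g y = α * y + β * y ^ p := by
    intro y
    rw [← hPg, hPe]; simp
  by_cases hα0 : α = 0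
  · exact ⟨β, Or.inr fun y => by rw [hge, hα0, zero_mul, zero_add]⟩
  by_cases hβ0 : β = 0
  · exact ⟨α, Or.inl fun y => by rw [hge, hβ0, zero_mul, add_zero]⟩
  exfalso
  have hC : ¬ p ∣ m.choose (2 * t + 1 + p) := by
    have hl := Choose.choose_modEq_choose_mod_mul_choose_div_nat (p := p) (n := m) (k := 2 * t + 1 + p)
    have e1 : m % p = 3 * t + 2 := by
      rw [hmm, Nat.mul_add_mod]; exact Nat.mod_eq_of_lt (by omega)
    have e2 : m / p = t := by
      rw [hmm, Nat.mul_add_div hp0, Nat.div_eq_of_lt (by omega : 3 * t + 2 < p), add_zero]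
    rw [e1, e2, Nat.add_mod_right, Nat.mod_eq_of_lt (by omega : 2 * t + 1 < p),
      Nat.add_div_right _ hp0, Nat.div_eq_of_lt (by omega : 2 * t + 1 < p),
      zero_add, Nat.choose_one_right] at hl
    rw [hl.dvd_iff dvd_rfl, hpf.out.dvd_mul, not_or]
    constructor
    · intro hdv
      have h3 := Nat.choose_mul_factorial_mul_factorial (by omega : 2 * t + 1 ≤ 3 * t + 2)
      have : p ∣ (3 * t + 2).factorial := by rw [← h3, mul_assoc]; exact hdv.mul_right _
      rw [hpf.out.dvd_factorial] at this
      omega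
    · intro hdv
      have := Nat.le_of_dvd (by omega) hdv
      omega
  have hpt : p ≤ p * t := Nat.le_mul_of_pos_right _ (by omega)
  have h4m : 4 * m = p * (4 * t + 2) + (4 * t + 2) := by rw [hmm, hp]; ring
  have h2m : 2 * m = p * (2 * t + 1) + (2 * t + 1) := by
    have : p * (4 * t + 2) = 2 * (p * (2 * t + 1)) := by ring
    omega
  have hmem : ∃ w : F → F, ∀ y, y ^ (2 * t + 1 + p) = ∑ x : F, w x * ppPsi p m a b (y - x) := by
    refine pp_pei_mem p m hq hme a b ha _ (m + p * (2 * t + 1) + 1) (by omega) hC (by omega) ?_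
    intro x
    by_cases hx : x = 0
    · subst hx
      rw [zero_pow (by omega), zero_pow (by omega), zero_pow (by omega)]
    have h := FiniteField.pow_card_sub_one_eq_one x hx
    rw [hq, Nat.add_sub_cancel] at h
    have e : (m + p * (2 * t + 1) + 1) * p = (3 * m + (2 * t + 1 + p)) + 4 * m * (3 * t + 1) := by
      have h5 : p * p = 4 * m + 1 := by rw [← hq, hqk, sq]
      calc (m + p * (2 * t + 1) + 1) * p = m * p + (p * p) * (2 * t + 1) + p := by ring
        _ = m * (4 * t + 3) + (4 * m + 1) * (2 * t + 1) + p := by rw [h5, ← hp]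
        _ = _ := by ring
    rw [← pow_mul, e, pow_add _ (3 * m + _), pow_mul x (4 * m), h, one_pow, mul_one]
  obtain ⟨w, hw⟩ := pp_transfer p m a b g hg _ hmem
  set R : F[X] := C (β ^ p) * X + C (α ^ p) * X ^ p with hR
  have hp1 : 1 < p := hpf.out.one_lt
  have degs : ∀ c d : F, d ≠ 0 → (C c * X + C d * X ^ p : F[X]).natDegree = p := by
    intro c d hd
    rw [natDegree_add_eq_right_of_natDegree_lt, natDegree_C_mul_X_pow _ _ hd]
    rw [natDegree_C_mul_X_pow _ _ hd]
    exact lt_of_le_of_lt ((natDegree_C_mul_le _ _).trans natDegree_X_le) hp1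
  have dP : P.natDegree = p := by rw [hPe]; exact degs _ _ hβ0
  have dR : R.natDegree = p := degs _ _ (pow_ne_zero _ hα0)
  have hP0 : P ≠ 0 := by rintro h; rw [h, natDegree_zero] at dP; omega
  have hR0 : R ≠ 0 := by rintro h; rw [h, natDegree_zero] at dR; omega
  have hdT : (P ^ (2 * t + 1) * R).natDegree = (2 * t + 2) * p := by
    rw [natDegree_mul (pow_ne_zero _ hP0) hR0, natDegree_pow, dP, dR]; ring
  have hN : (p ^ 2 - 1) / 2 = 2 * m := by rw [← hqk, hq]; omega
  have := pp_paley_coeff p m hq (P ^ (2 * t + 1) * R) ?_ w ?_ ((2 * t + 2) * p) ?_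
  · rw [← hdT, coeff_natDegree, leadingCoeff_eq_zero] at this
    exact mul_ne_zero (pow_ne_zero _ hP0) hR0 this
  · rw [hdT, hqk, sq]
    exact Nat.mul_lt_mul_of_pos_right (by omega) hp0
  · intro y
    rw [← hw, eval_mul, eval_pow, hPg, pow_add (g y) (2 * t + 1) p]
    congr 1
    have hy : (y ^ p) ^ p = y := by
      rw [← pow_mul, ← sq, ← hqk, FiniteField.pow_card]
    rw [hge, add_pow_char (p := p), mul_pow, mul_pow, hy]
    simp [hR]
    ring
  · rw [← hN]
    simpa using pp_bad p (2 * t + 1) (by omega) 2 1 (by omega)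

lemma pp_psi_val {F : Type*} [Field F] (p m t : ℕ) (hp : p = 4 * t + 3) (h2 : (2 : F) ≠ 0) (i : F)
    (hi : i ^ 2 = -1) (z : F) (n : ℕ) (hz : z ^ m = i ^ n) :
    ppPsi p m ((1 - i) / 2) ((1 + i) / 2) z = if n % 4 = 0 ∨ n % 4 = 1 then 1 else -1 := by
  have h4 : i ^ 4 = 1 := by
    rw [show 4 = 2 * 2 by norm_num, pow_mul, hi]; ring
  have hip : i ^ p = i ^ 3 := by
    rw [hp, pow_add, pow_mul, h4, one_pow, one_mul]
  have hn : i ^ n = i ^ (n % 4) := by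
    conv_lhs => rw [← Nat.div_add_mod n 4, pow_add, pow_mul, h4, one_pow, one_mul]
  unfold ppPsi
  rw [hz, ← pow_mul, mul_comm n p, pow_mul, hip, ← pow_mul, mul_comm 3 n, pow_mul, hn]
  have hlt : n % 4 < 4 := Nat.mod_lt _ (by norm_num)
  generalize n % 4 = r at hlt
  have h3 : i ^ 3 = - i := by rw [pow_succ, hi]; ring
  interval_cases r
  · simp; field_simp; ring
  · simp only [pow_one, h3]
    simp; field_simp
    linear_combination (-2) * hi
  · simp only [hi]
    simp; field_simp; ring
  · simp only [h3]
    have : (-i) ^ 3 = i := by linear_combination -h3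
    rw [this]
    simp; field_simp
    linear_combination (2) * hi

/-- Peisert. For `q = p^k > 9` with `p ≡ 3 (mod 4)` prime and `k` even,
the Paley graph on `GF(q)` is not isomorphic to the Peisert graph on `GF(q)`. -/
theorem paley_not_iso_peisert
    (p k q : ℕ) (hp : p.Prime) (hp4 : p % 4 = 3)
    (hk : 0 < k) (hkeven : Even k) (hq : q = p ^ k) (hq9 : 9 < q)
    (F : Type*) [Field F] [Fintype F] (hF : Fintype.card F = q)
    (ω : Fˣ) (hω : ∀ x : Fˣ, x ∈ Subgroup.zpowers ω) :
    ¬ ∃ e : F ≃ F, ∀ x y : F, paleyAdj x y ↔ peisertAdj ω (e x) (e y) := by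
  classical
  rintro ⟨e, he⟩
  have hpf : Fact p.Prime := ⟨hp⟩
  have hqk : Fintype.card F = p ^ k := hF.trans hq
  have : CharP F p := charP_of_card_eq_prime_pow hqk
  obtain ⟨t, ht⟩ : ∃ t, p = 4 * t + 3 := ⟨p / 4, by omega⟩
  obtain ⟨h, hh⟩ : ∃ h, k = 2 * h := by obtain ⟨c, hc⟩ := hkeven; exact ⟨c, by omega⟩
  have hq8 : Fintype.card F % 8 = 1 := by
    have hp2 : p ^ 2 % 8 = 1 := by
      rw [Nat.pow_mod]
      have : p % 8 = 3 ∨ p % 8 = 7 := by omega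
      rcases this with h | h <;> rw [h]
    rw [hqk, hh, pow_mul, Nat.pow_mod, hp2]
    simp
  obtain ⟨m, hm⟩ : ∃ m, Fintype.card F = 4 * m + 1 := ⟨Fintype.card F / 4, by omega⟩
  have hme : Even m := ⟨m / 2, by omega⟩
  have hm0 : 0 < m := by omega
  have h2 : (2 : F) ≠ 0 := by
    intro h0
    have : ((2 : ℕ) : F) = 0 := by exact_mod_cast h0
    rw [CharP.cast_eq_zero_iff F p] at this
    have := Nat.le_of_dvd (by norm_num) this
    omega
  have hord : orderOf ω = 4 * m := by
    rw [orderOf_eq_card_of_forall_mem_zpowers hω, Nat.card_units, Nat.card_eq_fintype_card, hm]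
    omega
  set i : F := ((ω ^ m : Fˣ) : F) with hi
  have hi4 : i ^ 4 = 1 := by
    have : (ω ^ m) ^ 4 = 1 := by rw [← pow_mul, mul_comm, ← hord, pow_orderOf_eq_one]
    rw [hi, ← Units.val_pow_eq_pow_val, this, Units.val_one]
  have hi2 : i ^ 2 = -1 := by
    have h1 : (i ^ 2 - 1) * (i ^ 2 + 1) = 0 := by linear_combination hi4
    rcases mul_eq_zero.1 h1 with h | h
    · exfalso
      have h3 : (ω ^ (m * 2) : Fˣ) = 1 := by
        rw [pow_mul]
        apply Units.ext
        rw [Units.val_pow_eq_pow_val, ← hi, Units.val_one]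
        linear_combination h
      have := Nat.le_of_dvd (by omega) (orderOf_dvd_of_pow_eq_one h3)
      omega
    · linear_combination h
  have hlog : ∀ z : F, z ≠ 0 → ∃ n : ℕ, z = (ω : F) ^ n := by
    intro z hz
    have h1 := hω (Units.mk0 z hz)
    rw [← mem_powers_iff_mem_zpowers] at h1
    obtain ⟨n, hn⟩ := h1
    refine ⟨n, ?_⟩
    have := congrArg Units.val hn
    simpa using this.symm
  have hωm : (ω : F) ^ m = i := by rw [hi, Units.val_pow_eq_pow_val]
  have hpown : ∀ n : ℕ, ((ω : F) ^ n) ^ m = i ^ n := by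
    intro n; rw [← pow_mul, mul_comm, pow_mul, hωm]
  set a : F := (1 - i) / 2 with ha
  set b : F := (1 + i) / 2 with hb
  have ha0 : a ≠ 0 := by
    intro h0
    have h1 : i = 1 := by
      rw [ha, div_eq_zero_iff] at h0
      rcases h0 with h0 | h0
      · linear_combination -h0
      · exact absurd h0 h2
    rw [h1] at hi2
    apply h2
    linear_combination hi2
  have hval : ∀ n : ℕ, ppPsi p m a b ((ω : F) ^ n) = if n % 4 = 0 ∨ n % 4 = 1 then 1 else -1 := by
    intro n
    exact pp_psi_val p m t ht h2 i hi2 _ n (hpown n)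
  have hpsi0 : ppPsi p m a b 0 = 0 := by
    simp [ppPsi, hm0.ne', hp.ne_zero]
  have hpodd : Odd p := ⟨2 * t + 1, by omega⟩
  have hpsip : ∀ z, ppPsi p m a b z ^ p = ppPsi p m a b z := by
    intro z
    by_cases hz : z = 0
    · rw [hz, hpsi0, zero_pow hp.ne_zero]
    · obtain ⟨n, rfl⟩ := hlog z hz
      rw [hval]
      split_ifs
      · simp
      · exact hpodd.neg_one_pow
  have hrel : ∀ x y, (y - x) ^ (2 * m) = ppPsi p m a b (e y - e x) := by
    intro x y
    by_cases hxy : y = x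
    · rw [hxy, sub_self, sub_self, hpsi0, zero_pow (by omega)]
    have hexy : e y ≠ e x := fun h => hxy (e.injective h)
    obtain ⟨n, hn⟩ := hlog (y - x) (sub_ne_zero.2 hxy)
    obtain ⟨r, hr⟩ := hlog (e y - e x) (sub_ne_zero.2 hexy)
    have hA : paleyAdj y x ↔ n % 2 = 0 := by
      constructor
      · rintro ⟨_, z, hz, hzz⟩
        obtain ⟨s, rfl⟩ := hlog z hz
        by_contra hodd
        have h1 : ((ω : F) ^ n) ^ m = (((ω : F) ^ s) ^ 2) ^ m := by rw [← hn, hzz]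
        rw [hpown, ← pow_mul (ω : F), hpown] at h1
        have h3 := congrArg (fun u => u ^ 2) h1
        simp only [← pow_mul] at h3
        rw [mul_comm n, pow_mul, hi2, mul_comm (s * 2), pow_mul, hi2,
          Odd.neg_one_pow (Nat.odd_iff.2 (by omega)), Even.neg_one_pow ⟨s, by ring⟩] at h3
        apply h2
        linear_combination -h3
      · intro h0
        refine ⟨hxy, (ω : F) ^ (n / 2), pow_ne_zero _ ω.ne_zero, ?_⟩
        rw [hn, ← pow_mul]
        congr 1
        omega
    have hB : peisertAdj ω (e y) (e x) ↔ (r % 4 = 0 ∨ r % 4 = 1) := by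
      constructor
      · rintro ⟨_, c, hc, hcc⟩
        rw [← mem_powers_iff_mem_zpowers] at hc
        obtain ⟨s, hs⟩ := hc
        have hs' : (c : F) = (ω : F) ^ (4 * s) := by
          rw [← hs]; simp [pow_mul]
        have hone : ppPsi p m a b (e y - e x) = 1 := by
          rcases hcc with h | h
          · rw [h, hs', hval, if_pos (by omega)]
          · rw [h, hs', ← pow_succ', hval, if_pos (by omega)]
        rw [hr, hval] at hone
        by_contra hcon
        rw [if_neg hcon] at hone
        apply h2
        linear_combination -hone
      · intro h0
        refine ⟨hexy, (ω ^ 4) ^ (r / 4), Subgroup.npow_mem_zpowers _ _, ?_⟩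
        rw [hr]
        rcases h0 with h0 | h0
        · left
          simp only [Units.val_pow_eq_pow_val, ← pow_mul]
          congr 1; omega
        · right
          simp only [Units.val_pow_eq_pow_val, ← pow_mul, ← pow_succ']
          congr 1; omega
    have hAB := he y x
    rw [hA, hB] at hAB
    rw [hn, hr, hval, mul_comm, pow_mul, hpown, ← pow_mul, mul_comm, pow_mul, hi2]
    by_cases h0 : n % 2 = 0
    · rw [if_pos (hAB.1 h0), Even.neg_one_pow (Nat.even_iff.2 h0)]
    · rw [if_neg (fun h => h0 (hAB.2 h)), Odd.neg_one_pow (Nat.odd_iff.2 (by omega))]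
  -- normalise so that `0 ↦ 0`
  set g : F ≃ F := e.trans (Equiv.subRight (e 0)) with hgdef
  have hgapp : ∀ x, g x = e x - e 0 := fun x => rfl
  have hg : ∀ x y, (y - x) ^ (2 * m) = ppPsi p m a b (g y - g x) := by
    intro x y
    rw [hgapp, hgapp, sub_sub_sub_cancel_right, hrel]
  have hg0 : g 0 = 0 := by rw [hgapp, sub_self]
  have hk2 : 2 ≤ k := by omega
  set P : F[X] := Lagrange.interpolate Finset.univ id (fun x => g x) with hP
  have hPg : ∀ y, P.eval y = g y := by
    intro y
    have := Lagrange.eval_interpolate_at_node (s := Finset.univ) (v := (id : F → F))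
      (fun x => g x) (Function.injective_id.injOn) (Finset.mem_univ y)
    exact this
  have hPd : P.natDegree < Fintype.card F := by
    by_cases h0 : P = 0
    · rw [h0, natDegree_zero]; omega
    · rw [natDegree_lt_iff_degree_lt h0]
      exact Lagrange.degree_interpolate_lt _ (Function.injective_id.injOn)
  have hlin := pp_lin p m t k ht hm0 hm hqk P hPd (by rw [hPg, hg0]) (by
    intro x1 x2 x3 x4
    have h1 := pp_Lpei p m t k ht hm0 hm hqk hk2 a b (g x1) (g x2) (g x3) (g x4)
    rw [← Equiv.sum_comp g] at h1
    simp_rw [← hg] at h1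
    simp_rw [hPg]
    exact h1)
  by_cases hk4 : 4 ≤ k
  · exact pp_caseA p m t k ht hm0 hme hm hqk hk4 hkeven a b ha0 hpsip g hg P hPd hPg hlin
  · have hk' : k = 2 := by omega
    subst hk'
    have ht1 : 1 ≤ t := by
      by_contra hcon
      have : p = 3 := by omega
      rw [hq, this] at hq9
      norm_num at hq9
    obtain ⟨c, hc⟩ := pp_caseB p m t ht ht1 hm0 hme hm hqk a b ha0 g hg P hPd hPg hlin
    have h1 := hg 0 1
    have h3 := hg 0 ((ω : F) ^ 2)
    have e1 : ((ω : F) ^ 2) ^ (2 * m) = 1 := by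
      rw [mul_comm, pow_mul, hpown, ← pow_mul, hi4]
    rw [hg0, sub_zero, sub_zero] at h1 h3
    rw [e1] at h3
    rw [one_pow] at h1
    have hneg : ppPsi p m a b (g ((ω : F) ^ 2)) = - ppPsi p m a b (g 1) := by
      have h5 : (g ((ω : F) ^ 2)) ^ m = - (g 1) ^ m := by
        rcases hc with hc | hc
        · rw [hc, hc, mul_one, mul_pow, hpown, hi2]; ring
        · rw [hc, hc, one_pow, mul_one, mul_pow, ← pow_mul (ω : F) 2 p, hpown, pow_mul, hi2, hpodd.neg_one_pow]
          ring
      unfold ppPsi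
      rw [h5, hpodd.neg_pow]
      ring
    rw [hneg, ← h1] at h3
    apply h2
    linear_combination h3
end

section
/- The graph on GF(4096) in which x ~ y iff x − y is a nonzero 13th power (note 4095 = 13·315, so the 13th powers form a subgroup of index 13 in GF(4096)*) is isomorphic to the bilinear forms graph H₄(2,3): the graph whose vertices are all 2×3 matrices over GF(4), two matrices being adjacent iff their difference has rank 1. -/
/-- A nonzero matrix has rank one iff it is an outer product of two vectors. -/
theorem rank_one_iff_outer {K : Type*} [Field K] (M : Matrix (Fin 2) (Fin 3) K) (hM : M ≠ 0) :
    M.rank = 1 ↔ ∃ (u : Fin 2 → K) (v : Fin 3 → K), ∀ i j, M i j = u i * v j := by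
  constructor
  · intro h
    rw [Matrix.rank, finrank_eq_one_iff'] at h
    obtain ⟨v0, _, hv⟩ := h
    choose r hr using fun j : Fin 3 =>
      hv ⟨M.mulVecLin (Pi.single j 1), LinearMap.mem_range_self _ _⟩
    refine ⟨v0.1, r, fun i j => ?_⟩
    have := congrFun (congrArg Subtype.val (hr j)) i
    simp at this
    rw [mul_comm, this]
  · rintro ⟨u, v, h⟩
    have hMv : M = Matrix.vecMulVec u v := by
      ext i j
      rw [h, Matrix.vecMulVec_apply]
    have h1 : M.rank ≤ 1 := hMv ▸ Matrix.rank_vecMulVec_le u v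
    have h2 : M.rank ≠ 0 := by
      intro h0
      rw [Matrix.rank, Submodule.finrank_eq_zero, LinearMap.range_eq_bot] at h0
      apply hM
      ext i j
      have := congrFun (LinearMap.congr_fun h0 (Pi.single j 1)) i
      simpa using this
    omega

/-- A finite field has intermediate fields of each degree dividing the full degree. -/
theorem exists_intermediate (K F : Type*) [Field K] [Finite K] [CharP K 2] [Field F] [Finite F]
    [Algebra K F] (n : ℕ) [NeZero n] (h : n ∣ Module.finrank K F) :
    ∃ E : IntermediateField K F, Module.finrank K E = n := by
  have h' : Module.finrank K (FiniteField.Extension K 2 n) ∣ Module.finrank K F := by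
    rwa [FiniteField.finrank_extension]
  obtain ⟨f⟩ := FiniteField.nonempty_algHom_of_finrank_dvd h'
  refine ⟨f.fieldRange, ?_⟩
  exact (AlgEquiv.ofInjectiveField f).toLinearEquiv.finrank_eq.symm.trans
    (FiniteField.finrank_extension K 2 n)

/-- Membership in a finite subfield of order `q` is characterised by `x ^ q = x`. -/
theorem mem_iff_pow {K F : Type*} [Field K] [Field F] [Finite F]
    [Algebra K F] (E : IntermediateField K F) (q : ℕ) (hq : 1 < q) (hE : Nat.card E = q) (x : F) :
    x ∈ E ↔ x ^ q = x := by
  classical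
  have := Fintype.ofFinite F
  have := Fintype.ofFinite E
  have hcard : Fintype.card E = q := by rw [← hE, Nat.card_eq_fintype_card]
  have hmem : ∀ y ∈ E, y ^ q = y := by
    intro y hy
    have := FiniteField.pow_card (⟨y, hy⟩ : E)
    rw [hcard] at this
    exact congrArg Subtype.val this
  refine ⟨hmem x, fun hx => ?_⟩
  have hne := FiniteField.X_pow_card_sub_X_ne_zero F hq
  let S : Finset F := Finset.univ.image (fun y : E => (y : F))
  let T : Finset F := (Polynomial.X ^ q - Polynomial.X : Polynomial F).roots.toFinset
  have hS : S.card = q := by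
    rw [Finset.card_image_of_injective _ Subtype.val_injective, Finset.card_univ, hcard]
  have hT : T.card ≤ q := by
    refine (Multiset.toFinset_card_le _).trans ((Polynomial.card_roots' _).trans ?_)
    rw [FiniteField.X_pow_card_sub_X_natDegree_eq F hq]
  have hT' : ∀ y, y ∈ T ↔ y ^ q = y := by
    intro y
    simp [T, hne, sub_eq_zero]
  have hST : S ⊆ T := by
    intro y hy
    obtain ⟨e, _, rfl⟩ := Finset.mem_image.1 hy
    exact (hT' _).2 (hmem _ e.2)
  have : x ∈ S := by
    rw [Finset.eq_of_subset_of_card_le hST (by omega)]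
    exact (hT' x).2 hx
  obtain ⟨e, _, rfl⟩ := Finset.mem_image.1 this
  exact e.2

theorem pow_pred_eq_one {F : Type*} [Field F] {x : F} (hx : x ≠ 0) (n : ℕ) (h : x ^ (n + 1) = x) :
    x ^ n = 1 := by
  have : x ^ n * x = 1 * x := by rw [← pow_succ, h, one_mul]
  exact mul_right_cancel₀ hx this

/-- Nonzero thirteenth powers are the products of nonzero elements of the subfields
of orders 16 and 64. -/
theorem thirteenth_iff {F : Type*} [Field F] [Fintype F] (hF : Fintype.card F = 4096)
    (d : F) (hd : d ≠ 0) :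
    (∃ z : F, z ≠ 0 ∧ d = z ^ 13) ↔ ∃ a b : F, a ^ 16 = a ∧ b ^ 64 = b ∧ d = a * b := by
  constructor
  · rintro ⟨z, hz, rfl⟩
    have hz1 : z ^ 4095 = 1 := by
      have := FiniteField.pow_card_sub_one_eq_one z hz
      rwa [hF] at this
    have h315 : (z ^ 13) ^ 315 = 1 := by rw [← pow_mul]; exact hz1
    generalize z ^ 13 = x at *
    refine ⟨x ^ 21, (x⁻¹) ^ 20, ?_, ?_, ?_⟩
    · calc (x ^ 21) ^ 16 = x ^ 315 * x ^ 21 := by ring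
        _ = x ^ 21 := by rw [h315, one_mul]
    · calc ((x⁻¹) ^ 20) ^ 64 = ((x ^ 315)⁻¹) ^ 4 * (x⁻¹) ^ 20 := by
            rw [← inv_pow]; generalize x⁻¹ = y; ring
        _ = (x⁻¹) ^ 20 := by rw [h315]; simp
    · rw [inv_pow]; field_simp
  · rintro ⟨a, b, ha, hb, rfl⟩
    have ha0 := left_ne_zero_of_mul hd
    have hb0 := right_ne_zero_of_mul hd
    have ha1 := pow_pred_eq_one ha0 15 ha
    have hb1 := pow_pred_eq_one hb0 63 hb
    refine ⟨a ^ 7 * b ^ 34, mul_ne_zero (pow_ne_zero _ ha0) (pow_ne_zero _ hb0), ?_⟩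
    calc a * b = (a ^ 15) ^ 6 * a * ((b ^ 63) ^ 7 * b) := by rw [ha1, hb1]; simp
      _ = (a ^ 7 * b ^ 34) ^ 13 := by ring


/-- Adjacency by nonzero 13th powers on a field: `x ~ y` iff `x - y = z¹³` for some
nonzero `z`. -/
def thirteenthPowerAdj {F : Type*} [Field F] (x y : F) : Prop :=
  x ≠ y ∧ ∃ z : F, z ≠ 0 ∧ x - y = z ^ 13

/-- Adjacency of the bilinear forms graph on `2 × 3` matrices over a field `K`:
two matrices are adjacent iff their difference has rank 1. -/
def bilinearFormsAdj {K : Type*} [Field K] (A B : Matrix (Fin 2) (Fin 3) K) : Prop :=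
  A ≠ B ∧ (A - B).rank = 1

/-- The graph on `GF(4096)` whose edges are the pairs differing by a
nonzero 13th power is isomorphic to the bilinear forms graph `H₄(2,3)` on `2 × 3`
matrices over `GF(4)`. -/
theorem thirteenthPowers4096_iso_bilinearForms
    (F : Type*) [Field F] [Fintype F] (hF : Fintype.card F = 4096)
    (K : Type*) [Field K] [Fintype K] (hK : Fintype.card K = 4) :
    ∃ e : F ≃ Matrix (Fin 2) (Fin 3) K,
      ∀ x y : F, thirteenthPowerAdj x y ↔ bilinearFormsAdj (e x) (e y) := by
  classical
  have : Fact (Nat.Prime 2) := ⟨Nat.prime_two⟩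
  have : CharP K 2 := charP_of_card_eq_prime_pow (f := 2) (by rw [hK]; norm_num)
  have : CharP F 2 := charP_of_card_eq_prime_pow (f := 12) (by rw [hF]; norm_num)
  obtain ⟨φ⟩ : Nonempty (K →+* F) := by
    letI := ZMod.algebra K 2
    letI := ZMod.algebra F 2
    have h1 : Module.finrank (ZMod 2) K = 2 := by
      have := Module.card_eq_pow_finrank (K := ZMod 2) (V := K)
      rw [hK, ZMod.card] at this
      exact Nat.pow_right_injective le_rfl (this.symm.trans (by norm_num : 4 = 2 ^ 2))
    have h2 : Module.finrank (ZMod 2) F = 12 := by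
      have := Module.card_eq_pow_finrank (K := ZMod 2) (V := F)
      rw [hF, ZMod.card] at this
      exact Nat.pow_right_injective le_rfl (this.symm.trans (by norm_num : 4096 = 2 ^ 12))
    obtain ⟨f⟩ := FiniteField.nonempty_algHom_of_finrank_dvd
      (F := ZMod 2) (K := K) (L := F) (by rw [h1, h2]; norm_num)
    exact ⟨f.toRingHom⟩
  letI : Algebra K F := φ.toAlgebra
  have hfr : Module.finrank K F = 6 := by
    have := Module.card_eq_pow_finrank (K := K) (V := F)
    rw [hF, hK] at this
    exact Nat.pow_right_injective (by norm_num : 2 ≤ 4)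
      (this.symm.trans (by norm_num : 4096 = 4 ^ 6))
  obtain ⟨A, hA⟩ := exists_intermediate K F 2 (by rw [hfr]; norm_num)
  obtain ⟨B, hB⟩ := exists_intermediate K F 3 (by rw [hfr]; norm_num)
  have hAm := mem_iff_pow A 16 (by norm_num) (by
    rw [Module.natCard_eq_pow_finrank (K := K), hA, Nat.card_eq_fintype_card, hK]; norm_num)
  have hBm := mem_iff_pow B 64 (by norm_num) (by
    rw [Module.natCard_eq_pow_finrank (K := K), hB, Nat.card_eq_fintype_card, hK]; norm_num)
  have hdis : A.LinearDisjoint B :=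
    IntermediateField.LinearDisjoint.of_finrank_coprime (by rw [hA, hB]; norm_num)
  let a : Module.Basis (Fin 2) K A := Module.finBasisOfFinrankEq K A hA
  let b : Module.Basis (Fin 3) K B := Module.finBasisOfFinrankEq K B hB
  have hli := hdis.linearIndependent_mul a.linearIndependent b.linearIndependent
  let c : Module.Basis (Fin 2 × Fin 3) K F :=
    basisOfLinearIndependentOfCardEqFinrank hli (by simp [hfr])
  have hc : ∀ i j, c (i, j) = (a i : F) * (b j : F) := by
    intro i j
    simp [c]
  let e : F ≃ Matrix (Fin 2) (Fin 3) K :=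
    c.equivFun.toEquiv.trans (Equiv.curry (Fin 2) (Fin 3) K)
  have he : ∀ x i j, e x i j = c.equivFun x (i, j) := fun x i j => rfl
  have hsub : ∀ x y, e x - e y = e (x - y) := by
    intro x y
    ext i j
    rw [Matrix.sub_apply, he, he, he, map_sub, Pi.sub_apply]
  have hsum : ∀ x, x = ∑ i, ∑ j, e x i j • ((a i : F) * (b j : F)) := by
    intro x
    conv_lhs => rw [← c.sum_equivFun x, Fintype.sum_prod_type]
    simp only [hc, he]
  have he0 : e 0 = 0 := by
    ext i j
    rw [he, map_zero]; rfl
  refine ⟨e, fun x y => ?_⟩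
  unfold thirteenthPowerAdj bilinearFormsAdj
  rw [hsub, e.injective.ne_iff]
  refine and_congr_right fun hxy => ?_
  have hd : x - y ≠ 0 := sub_ne_zero.2 hxy
  generalize x - y = d at hd
  have hMd : e d ≠ 0 := fun h => hd (e.injective (h.trans he0.symm))
  rw [thirteenth_iff hF d hd, rank_one_iff_outer _ hMd]
  constructor
  · rintro ⟨s, t, hs, ht, rfl⟩
    let s' : A := ⟨s, (hAm s).2 hs⟩
    let t' : B := ⟨t, (hBm t).2 ht⟩
    refine ⟨a.equivFun s', b.equivFun t', fun i j => ?_⟩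
    have h1 : s = ∑ i, a.equivFun s' i • (a i : F) := by
      have := congrArg A.val (a.sum_equivFun s')
      rw [map_sum] at this
      simp only [map_smul] at this
      exact this.symm
    have h2 : t = ∑ j, b.equivFun t' j • (b j : F) := by
      have := congrArg B.val (b.sum_equivFun t')
      rw [map_sum] at this
      simp only [map_smul] at this
      exact this.symm
    have h3 : s * t = ∑ p, (a.equivFun s' p.1 * b.equivFun t' p.2) • c p := by
      rw [Fintype.sum_prod_type]
      conv_lhs => rw [h1, h2, Finset.sum_mul_sum]
      simp only [hc, smul_mul_smul_comm]
    rw [he, h3]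
    have := c.equivFun.apply_symm_apply (fun p => a.equivFun s' p.1 * b.equivFun t' p.2)
    rw [Module.Basis.equivFun_symm_apply] at this
    rw [this]
  · rintro ⟨u, v, huv⟩
    refine ⟨((∑ i, u i • a i : A) : F), ((∑ j, v j • b j : B) : F),
      (hAm _).1 (Subtype.prop _), (hBm _).1 (Subtype.prop _), ?_⟩
    rw [hsum d]
    simp only [huv]
    push_cast
    rw [Finset.sum_mul_sum]
    simp only [IntermediateField.coe_smul, smul_mul_smul_comm]
end

section
/- Let ω be a generator of GF(49)*. The automorphism group of the Peisert graph on GF(49) (vertices GF(49), x ~ y iff x − y ∈ ⟨ω⁴⟩ ∪ ω⟨ω⁴⟩) has order 3528. -/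
namespace P49

abbrev V := ZMod 7 × ZMod 7
abbrev Q := ZMod 7 × ZMod 7 × ZMod 7 × ZMod 7

def code (v : V) : ℕ := 7 * v.1.val + v.2.val
/-- indicator of the connection set -/
def inS (v : V) : Bool := Nat.testBit 59976339085566 (code v)
def adj (x y : V) : Bool := inS (x - y)
def ref (c : V → ℕ) (v : V) : ℕ :=
  (c v * 31 + ∑ w : V, if adj v w then c w * c w else 0) % 10007
def tab (N : ℕ) (v : V) : ℕ := (N >>> (14 * code v)) % 16384

def t0 (v : V) : ℕ := if v = 0 then 1 else if v = (1, 0) then 2 else 5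
def u0 (v : V) : ℕ := if v = 0 then 1 else if v = (1, 0) then 2 else if v = (0, 1) then 3 else 5
def t1 : V → ℕ := tab 14384024446081632978009661830354301586609455575812831287871362704151867962437910695547063567364434844317506918801993189422271932308147551226025734821453132268033361140639138278276372330618019161995434443362
def t2 : V → ℕ := tab 3732520996313732882604017498630647167775919726180832664155010868924372233253530105737417619981498196411933380363216055089219071156017123211140499724567823834496176890600527918769506641619062529242220417655
def t3 : V → ℕ := tab 82290882219159518931107635509015048544598428667331179240102870208681953262372335874782974614574004129271466190004291720475897253654414119758531189886428745302770897254944622566360606871261872039620394526400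
def t4 : V → ℕ := tab 132902395454778605396699404264304576606594014038310953532470079328113112531166982483830158905536751105157989447641439195192047669352615431744137218850684013647312240559485706928918248525044502336504773565233
def u1 : V → ℕ := tab 14384024444913576891763463938585461943311098338340274625102625161142817666534942906617379381140826552853453737006422046442540497561913387433532310012261742371449523362722091677174545579758452199722878190162
def u2 : V → ℕ := tab 14462086606498921202090762367467293687806332016390875713976803124653119177937658540501847790601485295146873760393141063149220090487456581666359004854488534782595496357823624760563701424638556956358372432933
def u3 : V → ℕ := tab 49734239735099913063762516104900945115177626578670821988044282756862820929416482452017685697505433554651437258400580844377308985525392582417973779032854538711765608056891288221943531704689543970643545663234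

def lin (M : Q) (v : V) : V := (M.1 * v.1 + M.2.1 * v.2, M.2.2.1 * v.1 + M.2.2.2 * v.2)
def qmul (M N : Q) : Q :=
  (M.1 * N.1 + M.2.1 * N.2.2.1, M.1 * N.2.1 + M.2.1 * N.2.2.2,
   M.2.2.1 * N.1 + M.2.2.2 * N.2.2.1, M.2.2.1 * N.2.1 + M.2.2.2 * N.2.2.2)
def det (M : Q) : ZMod 7 := M.1 * M.2.2.2 - M.2.1 * M.2.2.1
def St : List Q := [(1,0,0,1), (1,4,0,2), (1,5,0,4)]
/-- coset representatives -/
def R : List Q :=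
  [(0,1,3,5), (0,1,5,4), (0,1,6,0), (0,3,1,5), (0,3,2,1), (0,3,4,0),
   (1,0,0,1), (1,0,4,2), (1,0,5,4), (2,0,0,2), (2,0,1,4), (2,0,3,1),
   (3,0,0,3), (3,0,1,5), (3,0,5,6), (4,0,0,4), (4,0,2,1), (4,0,6,2),
   (5,0,0,5), (5,0,4,6), (5,0,6,3), (6,0,0,6), (6,0,2,3), (6,0,3,5)]
/-- the linear maps preserving the connection set -/
def L : List Q := R.flatMap fun M => St.map (qmul M)

theorem ref_t0 : ∀ v, ref t0 v = t1 v := by decide +kernel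
theorem ref_t1 : ∀ v, ref t1 v = t2 v := by decide +kernel
theorem ref_t2 : ∀ v, ref t2 v = t3 v := by decide +kernel
theorem ref_t3 : ∀ v, ref t3 v = t4 v := by decide +kernel
theorem ref_u0 : ∀ v, ref u0 v = u1 v := by decide +kernel
theorem ref_u1 : ∀ v, ref u1 v = u2 v := by decide +kernel
theorem ref_u2 : ∀ v, ref u2 v = u3 v := by decide +kernel

theorem t4_sep : ∀ v, t4 v = t4 (0, 1) → ∃ M ∈ St, lin M (0, 1) = v := by decide +kernel
theorem u3_inj : ∀ v w, u3 v = u3 w → v = w := by decide +kernel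
theorem St_fix : ∀ M ∈ St, lin M (1, 0) = (1, 0) := by decide +kernel
theorem L_trans : ∀ v, inS v = true → ∃ M ∈ R, lin M (1, 0) = v := by decide +kernel
theorem R_inS : ∀ M ∈ R, ∀ v, inS (lin M v) = inS v := by decide +kernel
theorem St_inS : ∀ M ∈ St, ∀ v, inS (lin M v) = inS v := by decide +kernel
theorem R_det : ∀ M ∈ R, det M ≠ 0 := by decide +kernel
theorem St_det : ∀ M ∈ St, det M ≠ 0 := by decide +kernel
theorem L_nodup : L.Nodup := by decide +kernel
theorem L_len : L.length = 72 := by decide +kernel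

theorem ker_of_det (M : Q) (h : det M ≠ 0) (v : V) (hv : lin M v = 0) : v = 0 := by
  have : Fact (Nat.Prime 7) := ⟨by norm_num⟩
  have h1 : M.1 * v.1 + M.2.1 * v.2 = 0 := congrArg Prod.fst hv
  have h2 : M.2.2.1 * v.1 + M.2.2.2 * v.2 = 0 := congrArg Prod.snd hv
  have e1 : det M * v.1 = 0 := by
    unfold det; linear_combination M.2.2.2 * h1 - M.2.1 * h2
  have e2 : det M * v.2 = 0 := by
    unfold det; linear_combination M.1 * h2 - M.2.2.1 * h1
  exact Prod.ext ((mul_eq_zero.mp e1).resolve_left h) ((mul_eq_zero.mp e2).resolve_left h)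

theorem lin_add (M : Q) (v w : V) : lin M (v + w) = lin M v + lin M w := by
  ext <;> simp [lin] <;> ring

theorem lin_sub (M : Q) (v w : V) : lin M (v - w) = lin M v - lin M w := by
  ext <;> simp [lin] <;> ring

theorem lin_qmul (M N : Q) (v : V) : lin (qmul M N) v = lin M (lin N v) := by
  ext <;> simp [lin, qmul] <;> ring

theorem lin_zero (M : Q) : lin M 0 = 0 := by
  ext <;> simp [lin]

theorem mem_L {M : Q} : M ∈ L ↔ ∃ A ∈ R, ∃ B ∈ St, qmul A B = M := by
  unfold L
  rw [List.mem_flatMap]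
  constructor
  · rintro ⟨A, hA, h⟩
    obtain ⟨B, hB, e⟩ := List.mem_map.mp h
    exact ⟨A, hA, B, hB, e⟩
  · rintro ⟨A, hA, B, hB, e⟩
    exact ⟨A, hA, List.mem_map.mpr ⟨B, hB, e⟩⟩

/-- good matrices: invertible and preserving the connection set -/
def Good (M : Q) : Prop := (∀ v, inS (lin M v) = inS v) ∧ ∀ v, lin M v = 0 → v = 0

theorem good_R {M : Q} (h : M ∈ R) : Good M := ⟨R_inS M h, ker_of_det M (R_det M h)⟩
theorem good_St {M : Q} (h : M ∈ St) : Good M := ⟨St_inS M h, ker_of_det M (St_det M h)⟩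
theorem good_L {M : Q} (h : M ∈ L) : Good M := by
  obtain ⟨A, hA, B, hB, rfl⟩ := mem_L.mp h
  refine ⟨fun v => ?_, fun v hv => ?_⟩
  · rw [lin_qmul, (good_R hA).1, (good_St hB).1]
  · rw [lin_qmul] at hv
    exact (good_St hB).2 _ ((good_R hA).2 _ hv)

def IsAut (σ : Equiv.Perm V) : Prop := ∀ x y, adj x y = adj (σ x) (σ y)

theorem ref_inv {ρ : Equiv.Perm V} (h : IsAut ρ) {c : V → ℕ} (hc : ∀ v, c (ρ v) = c v) (v : V) :
    ref c (ρ v) = ref c v := by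
  unfold ref
  have hs : (∑ w : V, if adj v w then c w * c w else 0)
      = ∑ w : V, if adj (ρ v) w then c w * c w else 0 := by
    apply Fintype.sum_equiv ρ
    intro w
    rw [hc, h v w]
  rw [hc, hs]

theorem t4_inv {ρ : Equiv.Perm V} (h : IsAut ρ) (h0 : ρ 0 = 0) (h1 : ρ (1, 0) = (1, 0)) (v : V) :
    t4 (ρ v) = t4 v := by
  have k0 : ∀ v, t0 (ρ v) = t0 v := by
    intro v
    have e0 : ρ v = 0 ↔ v = 0 := by
      constructor
      · intro e; exact ρ.injective (e.trans h0.symm)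
      · rintro rfl; exact h0
    have e1 : ρ v = (1, 0) ↔ v = (1, 0) := by
      constructor
      · intro e; exact ρ.injective (e.trans h1.symm)
      · rintro rfl; exact h1
    simp only [t0, e0, e1]
  have k1 : ∀ v, t1 (ρ v) = t1 v := fun v => by
    rw [← ref_t0, ← ref_t0]; exact ref_inv h k0 v
  have k2 : ∀ v, t2 (ρ v) = t2 v := fun v => by
    rw [← ref_t1, ← ref_t1]; exact ref_inv h k1 v
  have k3 : ∀ v, t3 (ρ v) = t3 v := fun v => by
    rw [← ref_t2, ← ref_t2]; exact ref_inv h k2 v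
  rw [← ref_t3, ← ref_t3]; exact ref_inv h k3 v

theorem u3_inv {ρ : Equiv.Perm V} (h : IsAut ρ) (h0 : ρ 0 = 0) (h1 : ρ (1, 0) = (1, 0))
    (h2 : ρ (0, 1) = (0, 1)) (v : V) : u3 (ρ v) = u3 v := by
  have k0 : ∀ v, u0 (ρ v) = u0 v := by
    intro v
    have e0 : ρ v = 0 ↔ v = 0 := by
      constructor
      · intro e; exact ρ.injective (e.trans h0.symm)
      · rintro rfl; exact h0
    have e1 : ρ v = (1, 0) ↔ v = (1, 0) := by
      constructor
      · intro e; exact ρ.injective (e.trans h1.symm)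
      · rintro rfl; exact h1
    have e2 : ρ v = (0, 1) ↔ v = (0, 1) := by
      constructor
      · intro e; exact ρ.injective (e.trans h2.symm)
      · rintro rfl; exact h2
    simp only [u0, e0, e1, e2]
  have k1 : ∀ v, u1 (ρ v) = u1 v := fun v => by
    rw [← ref_u0, ← ref_u0]; exact ref_inv h k0 v
  have k2 : ∀ v, u2 (ρ v) = u2 v := fun v => by
    rw [← ref_u1, ← ref_u1]; exact ref_inv h k1 v
  rw [← ref_u2, ← ref_u2]; exact ref_inv h k2 v

theorem exists_affPerm (M : Q) (hM : Good M) (b : V) :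
    ∃ σ : Equiv.Perm V, IsAut σ ∧ ∀ v, σ v = lin M v + b := by
  have hinj : Function.Injective (fun v => lin M v + b) := by
    intro v w e
    have e' : lin M v = lin M w := add_right_cancel e
    have : lin M (v - w) = 0 := by rw [lin_sub, e', sub_self]
    exact sub_eq_zero.mp (hM.2 _ this)
  refine ⟨Equiv.ofBijective _ (Finite.injective_iff_bijective.mp hinj), ?_, fun v => rfl⟩
  intro x y
  change inS _ = inS ((lin M x + b) - (lin M y + b))
  rw [add_sub_add_right_eq_sub, ← lin_sub, hM.1]

theorem IsAut.trans {σ τ : Equiv.Perm V} (h : IsAut σ) (k : IsAut τ) : IsAut (σ.trans τ) :=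
  fun x y => (h x y).trans (k _ _)

theorem IsAut.symm {σ : Equiv.Perm V} (h : IsAut σ) : IsAut σ.symm := by
  intro x y
  have := h (σ.symm x) (σ.symm y)
  simpa using this.symm

theorem aut_lin {τ : Equiv.Perm V} (h : IsAut τ) (h0 : τ 0 = 0) :
    ∃ M ∈ L, ∀ v, τ v = lin M v := by
  have hs : inS (τ (1, 0)) = true := by
    have := h (1, 0) 0
    rw [h0] at this
    simp only [adj, sub_zero] at this
    rw [← this]; decide +kernel
  obtain ⟨M, hM, hM1⟩ := L_trans _ hs
  obtain ⟨μ, hμ, hμv⟩ := exists_affPerm M (good_R hM) 0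
  simp only [add_zero] at hμv
  have hρ : IsAut (τ.trans μ.symm) := h.trans hμ.symm
  have r0 : (τ.trans μ.symm) 0 = 0 := by
    rw [Equiv.trans_apply, Equiv.symm_apply_eq, h0, hμv, lin_zero]
  have r1 : (τ.trans μ.symm) (1, 0) = (1, 0) := by
    rw [Equiv.trans_apply, Equiv.symm_apply_eq, hμv, hM1]
  obtain ⟨N, hN, hN2⟩ := t4_sep _ (t4_inv hρ r0 r1 (0, 1))
  obtain ⟨ν, hν, hνv⟩ := exists_affPerm N (good_St hN) 0
  simp only [add_zero] at hνv
  have hρ' := hρ.trans hν.symm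
  have key := u3_inv hρ'
    (by rw [Equiv.trans_apply, Equiv.symm_apply_eq, r0, hνv, lin_zero])
    (by rw [Equiv.trans_apply, Equiv.symm_apply_eq, r1, hνv, St_fix N hN])
    (by rw [Equiv.trans_apply, Equiv.symm_apply_eq, hνv, hN2])
  refine ⟨qmul M N, mem_L.mpr ⟨M, hM, N, hN, rfl⟩, fun v => ?_⟩
  have e := u3_inj _ _ (key v)
  rw [Equiv.trans_apply, Equiv.symm_apply_eq, Equiv.trans_apply, Equiv.symm_apply_eq, hνv, hμv] at e
  rw [e, lin_qmul]

theorem aut_aff {σ : Equiv.Perm V} (h : IsAut σ) : ∃ M ∈ L, ∀ v, σ v = lin M v + σ 0 := by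
  have h' : IsAut (σ.trans (Equiv.subRight (σ 0))) := by
    intro x y
    rw [h x y]
    simp [adj]
  obtain ⟨M, hM, e⟩ := aut_lin h' (by simp)
  refine ⟨M, hM, fun v => ?_⟩
  rw [← e]; simp

theorem lin_inj {M N : Q} (h : ∀ v, lin M v = lin N v) : M = N := by
  have h1 := h (1, 0)
  have h2 := h (0, 1)
  simp only [lin, mul_one, mul_zero, add_zero, zero_add, Prod.mk.injEq] at h1 h2
  ext
  exacts [h1.1, h2.1, h1.2, h2.2]

theorem card_aut : Set.ncard {σ : Equiv.Perm V | IsAut σ} = 3528 := by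
  obtain ⟨P, hc, hmem⟩ : ∃ P : Finset (Q × V), P.card = 3528 ∧ ∀ p, p ∈ (P : Set (Q × V)) ↔ p.1 ∈ L := by
    refine ⟨L.toFinset ×ˢ (Finset.univ : Finset V), ?_, fun p => ?_⟩
    · rw [Finset.card_product, List.toFinset_card_of_nodup L_nodup, L_len]
      simp [ZMod.card]
    · rw [Finset.mem_coe, Finset.mem_product, List.mem_toFinset]
      exact and_iff_left (Finset.mem_univ _)
  rw [← hc, ← Set.ncard_coe_finset]
  symm
  choose f hf hfv using exists_affPerm
  refine Set.ncard_congr (fun p hp => f p.1 (good_L ((hmem p).mp hp)) p.2) ?_ ?_ ?_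
  · intro p hp
    exact hf _ _ _
  · rintro ⟨M, b⟩ ⟨N, c⟩ hp hq e
    have e' : ∀ v, lin M v + b = lin N v + c := by
      intro v
      rw [← hfv M (good_L ((hmem _).mp hp)), ← hfv N (good_L ((hmem _).mp hq))]
      exact congrArg (fun s : Equiv.Perm V => s v) e
    have hb : b = c := by simpa [lin_zero] using e' 0
    subst hb
    have : M = N := lin_inj fun v => add_right_cancel (e' v)
    rw [this]
  · intro σ hσ
    obtain ⟨M, hM, e⟩ := aut_aff hσ
    refine ⟨(M, σ 0), (hmem _).mpr hM, ?_⟩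
    ext1 v
    rw [hfv]
    exact (e v).symm

/-- multiplication of `a + b i` -/
def vmul (x y : V) : V := (x.1 * y.1 - x.2 * y.2, x.1 * y.2 + x.2 * y.1)
def v3 (x : V) : V := vmul x (vmul x x)
def v12 (x : V) : V := vmul (vmul (v3 x) (v3 x)) (vmul (v3 x) (v3 x))

theorem inS_iff : ∀ x : V, (v12 x = (1, 0) ∨ v12 x = (0, 1)) ↔ inS x = true := by decide +kernel
theorem norm_zero : ∀ a b : ZMod 7, a * a + b * b = 0 → a = 0 ∧ b = 0 := by decide +kernel

theorem transfer (F : Type*) [Field F] [Fintype F] (hF : Fintype.card F = 49)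
    (ω : Fˣ) (hω : ∀ x : Fˣ, x ∈ Subgroup.zpowers ω) :
    ∃ φ : V ≃ F, ∀ x y, peisertAdj ω (φ x) (φ y) ↔ adj x y = true := by
  classical
  have hord : orderOf ω = 48 := by
    rw [orderOf_eq_card_of_forall_mem_zpowers hω, Nat.card_eq_fintype_card, Fintype.card_units, hF]
  have : Fact (Nat.Prime 7) := ⟨by norm_num⟩
  have : CharP F 7 := by
    obtain ⟨p, hp⟩ := CharP.exists F
    obtain ⟨n, hpp, hn⟩ := FiniteField.card F p
    rw [hF] at hn
    have hd : p ∣ 7 ^ 2 := by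
      rw [show 7 ^ 2 = 49 by norm_num, hn]; exact dvd_pow_self p n.ne_zero
    have := (Nat.prime_dvd_prime_iff_eq hpp (by norm_num)).mp (hpp.dvd_of_dvd_pow hd)
    rwa [← this]
  let ι : ZMod 7 →+* F := ZMod.castHom (dvd_refl 7) F
  have hι : Function.Injective ι := ι.injective
  let i : F := ((ω ^ 12 : Fˣ) : F)
  have hi : i * i = -1 := by
    have h1 : (ω ^ 24 : Fˣ) ≠ 1 := by
      intro h
      have := orderOf_dvd_of_pow_eq_one h
      rw [hord] at this
      norm_num at this
    have h2 : ((ω ^ 24 : Fˣ) : F) * ((ω ^ 24 : Fˣ) : F) = 1 := by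
      rw [← Units.val_mul, ← pow_add, show 24 + 24 = orderOf ω by rw [hord], pow_orderOf_eq_one]; rfl
    have h3 : i * i = ((ω ^ 24 : Fˣ) : F) := by
      rw [← Units.val_mul, ← pow_add]
    rw [h3]
    rcases mul_self_eq_one_iff.mp h2 with h | h
    · exact absurd (Units.ext h) h1
    · exact h
  let φ : V → F := fun v => ι v.1 + ι v.2 * i
  have φsub : ∀ x y, φ (x - y) = φ x - φ y := by
    intro x y; simp only [φ, Prod.fst_sub, Prod.snd_sub, map_sub]; ring
  have φmul : ∀ x y, φ (vmul x y) = φ x * φ y := by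
    intro x y; simp only [φ, vmul, map_sub, map_add, map_mul]
    linear_combination (-ι x.2 * ι y.2) * hi
  have φ0 : ∀ x, φ x = 0 → x = 0 := by
    rintro ⟨a, b⟩ h
    have h' : ι a + ι b * i = 0 := h
    have : ι (a * a + b * b) = 0 := by
      simp only [map_add, map_mul]
      linear_combination (ι a - ι b * i) * h' + ι b * ι b * hi
    have := norm_zero a b (hι (this.trans (map_zero ι).symm))
    ext
    exacts [this.1, this.2]
  have φinj : Function.Injective φ := by
    intro x y e
    exact sub_eq_zero.mp (φ0 _ (by rw [φsub, e, sub_self]))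
  have φbij : Function.Bijective φ := by
    rw [Fintype.bijective_iff_injective_and_card]
    exact ⟨φinj, by rw [hF]; simp [ZMod.card]⟩
  have φ12 : ∀ x, φ (v12 x) = φ x ^ 12 := by
    intro x; simp only [v12, v3, φmul]; ring
  have φone : φ (1, 0) = 1 := by simp [φ]
  have φi : φ (0, 1) = i := by simp [φ]
  have hz : ∀ z : F, (z ≠ 0 ∧ ∃ c : Fˣ, c ∈ Subgroup.zpowers (ω ^ 4) ∧
      (z = (c : F) ∨ z = (ω : F) * (c : F))) ↔ (z ^ 12 = 1 ∨ z ^ 12 = i) := by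
    intro z
    constructor
    · rintro ⟨-, c, hc, h⟩
      have hc12 : (c : F) ^ 12 = 1 := by
        obtain ⟨m, rfl⟩ := Subgroup.mem_zpowers_iff.mp hc
        rw [← Units.val_pow_eq_pow_val, ← zpow_natCast, ← zpow_mul, mul_comm, zpow_mul,
          zpow_natCast, ← pow_mul, show 4 * 12 = orderOf ω by rw [hord], pow_orderOf_eq_one]
        simp
      rcases h with rfl | rfl
      · exact Or.inl hc12
      · right
        rw [mul_pow, hc12, mul_one]; simp [i]
    · intro h
      have hz0 : z ≠ 0 := by
        rintro rfl
        rcases h with h | h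
        · simp at h
        · rw [zero_pow (by norm_num)] at h
          exact (ω ^ 12 : Fˣ).ne_zero h.symm
      refine ⟨hz0, ?_⟩
      obtain ⟨n, hn⟩ := Subgroup.mem_zpowers_iff.mp (hω (Units.mk0 z hz0))
      have hzn : z = ((ω ^ n : Fˣ) : F) := by rw [hn]; rfl
      rcases h with h | h
      · have h1 : ω ^ (n * 12) = 1 := by
          apply Units.ext
          rw [zpow_mul, Units.val_zpow_eq_zpow_val, ← hzn]
          exact_mod_cast h
        have h2 := orderOf_dvd_iff_zpow_eq_one.mpr h1
        rw [hord] at h2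
        obtain ⟨m, rfl⟩ : (4 : ℤ) ∣ n := by omega
        refine ⟨ω ^ (4 * m), ?_, Or.inl hzn⟩
        exact Subgroup.mem_zpowers_iff.mpr ⟨m, by rw [zpow_mul]; norm_cast⟩
      · have h0 : ω ^ (n * 12) = ω ^ (12 : ℤ) := by
          apply Units.ext
          rw [zpow_mul, Units.val_zpow_eq_zpow_val, ← hzn]
          exact_mod_cast h
        have h1 : ω ^ (n * 12 - 12) = 1 := by
          rw [zpow_sub, h0, mul_inv_cancel]
        have h2 := orderOf_dvd_iff_zpow_eq_one.mpr h1
        rw [hord] at h2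
        obtain ⟨m, hm⟩ : (4 : ℤ) ∣ n - 1 := by omega
        obtain rfl : n = 1 + 4 * m := by omega
        refine ⟨ω ^ (4 * m), ?_, Or.inr ?_⟩
        · exact Subgroup.mem_zpowers_iff.mpr ⟨m, by rw [zpow_mul]; norm_cast⟩
        · rw [hzn, zpow_add, zpow_one, Units.val_mul]
  refine ⟨Equiv.ofBijective φ φbij, fun x y => ?_⟩
  change peisertAdj ω (φ x) (φ y) ↔ inS (x - y) = true
  unfold peisertAdj
  rw [← sub_ne_zero, hz, ← inS_iff, ← φsub, ← φ12, ← φone, ← φi, φinj.eq_iff, φinj.eq_iff]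

end P49

/-- The automorphism group of the Peisert graph on `GF(49)`
has order `3528`. -/
theorem peisert49_aut_card
    (F : Type*) [Field F] [Fintype F] (hF : Fintype.card F = 49)
    (ω : Fˣ) (hω : ∀ x : Fˣ, x ∈ Subgroup.zpowers ω) :
    Set.ncard {σ : Equiv.Perm F | ∀ x y : F, peisertAdj ω x y ↔ peisertAdj ω (σ x) (σ y)}
      = 3528 := by
  obtain ⟨φ, hφ⟩ := P49.transfer F hF ω hω
  rw [← P49.card_aut, ← Set.ncard_image_of_injective _ φ.permCongr.injective]
  congr 1
  ext σ
  simp only [Set.mem_ofPred_eq, Set.mem_image]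
  constructor
  · intro h
    refine ⟨φ.symm.permCongr σ, ?_, ?_⟩
    · intro x y
      rw [Bool.eq_iff_iff, ← hφ, ← hφ, h]
      simp
    · ext x; simp
  · rintro ⟨τ, hτ, rfl⟩ x y
    obtain ⟨x, rfl⟩ := φ.surjective x
    obtain ⟨y, rfl⟩ := φ.surjective y
    have := hτ x y
    simp only [Equiv.permCongr_apply, Equiv.symm_apply_apply]
    rw [hφ, hφ, this]
end

section
/- Let ω be a generator of GF(81)*. The automorphism group of the Peisert graph on GF(81) (vertices GF(81), x ~ y iff x − y ∈ ⟨ω⁴⟩ ∪ ω⟨ω⁴⟩) has order 38880. -/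
namespace Peisert81

/-- Packed adjacency matrix of the model graph on `{0, …, 80}`. -/
def big : ℕ := 5698727045937910709838547869989956494618579550424933586716948793080870884090285967088120590898974633030842623365932370077073548373909777864238654914882140962887465750898381146920375841073012416076113012304907078087312727545682147662009037527959279513759521082172659310390256378522306345150176154405544170167449078733708443735762758415779114767980105976973133048410641626993642362117885734168001995337517119717189008867210896163941805242544972842995402597205744971649096385487443320566022902073419026950897680344613730381496423621256552505430522777715844201584119221230868443655909632285814385334071343753217180072931990036895329497026596331696927498252830546264382639924063927066341357800453573155452215257835472561049843281395668293889571386358603651759062076518642785502792902498574169724766637960392940985990348709336291276396659045457329780071817089440712810804406905740236252648472291250732894442926259544589609534609507725036494632893091611184112097345433810331751455130780910281850464852538531345411728086689427836320959646976237123477092673348669872087089379133411108711081765530768630380886814329441402599466192124000255908501169411283222335560523585675223554781491135270951050201657396640928547714074764222158020531052545627593158274000012456929131645165446054857332123896274212230897052223577827047685942571823648304372871467707761216332002496071227990588076037048124521145755254901935595938978427670279054883181005560059292401630261610869305623610180497708860154332179008262426210121013175838680161213393647846558516611588032974558072700923591958620903777251795867387862077579852088014071208034645438628975823412100329141343780885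540906803450593196068003354417840620104038997050672597803335559227929879868697131540560572903123514762971598381467139743321572220868093944841593351082062898032723029153553045575290856915665511324460224988808660273750508254168564856258061112439676235810991531068408458217860399162998979152656928331948019039247584526387363848434265598

/-- Packed connection set. -/
def conn : ℕ := 2155042944838284284046846

def row (v : ℕ) : ℕ := Nat.land (Nat.shiftRight big (Nat.mul 81 v)) 2417851639229258349412351

def bit (m v : ℕ) : Bool := Nat.beq (Nat.land (Nat.shiftRight m v) 1) 1

/-- Adjacency in the model. -/
def adj (u v : ℕ) : Bool := bit (row u) v

/-- Vertices which may be the image of a vertex related to `u` as told by `b`, when `u ↦ x`. -/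
def msk (b : Bool) (x : ℕ) : ℕ :=
  match b with
  | true => row x
  | false => Nat.xor 2417851639229258349412351 (Nat.lor (row x) (Nat.shiftLeft 1 x))

/-- Candidates for the image of the vertex with row `r`. -/
def cand (r : ℕ) : List (ℕ × ℕ) → ℕ → ℕ
  | [], m => m
  | (u, x) :: c, m => cand r c (Nat.land m (msk (bit r u) x))

/-- Extend `c` by `v ↦ lo + w` for all `w < n` with bit `w` set in `m`. -/
def exts (v : ℕ) (c : List (ℕ × ℕ)) (m lo : ℕ) : ℕ → List (List (ℕ × ℕ)) → List (List (ℕ × ℕ))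
  | 0, acc => acc
  | n + 1, acc => exts v c m lo n (match bit m n with
      | true => ((v, Nat.add lo n) :: c) :: acc
      | false => acc)

/-- The same, blockwise. -/
def extb (v : ℕ) (c : List (ℕ × ℕ)) (m : ℕ) : ℕ → List (List (ℕ × ℕ)) → List (List (ℕ × ℕ))
  | 0, acc => acc
  | j + 1, acc => extb v c m j (match Nat.land (Nat.shiftRight m (Nat.mul 9 j)) 511 with
      | 0 => acc
      | k + 1 => exts v c (k + 1) (Nat.mul 9 j) 9 acc)

def step (v : ℕ) : List (List (ℕ × ℕ)) → List (List (ℕ × ℕ))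
  | [] => []
  | c :: L => extb v c (cand (row v) c 2417851639229258349412351) 9 (step v L)

def search : List ℕ → List (List (ℕ × ℕ)) → List (List (ℕ × ℕ))
  | [], L => L
  | v :: o, L => search o (step v L)

def ord : List ℕ := [2, 3, 9, 8, 20, 41, 29, 4, 10, 5, 6, 7, 11, 12, 13, 14, 15, 16, 17, 18, 19, 21, 22, 23, 24, 25, 26, 27, 28, 30, 31, 32, 33, 34, 35, 36, 37, 38, 39, 40, 42, 43, 44, 45, 46, 47, 48, 49, 50, 51, 52, 53, 54, 55, 56, 57, 58, 59, 60, 61, 62, 63, 64, 65, 66, 67, 68, 69, 70, 71, 72, 73, 74, 75, 76, 77, 78, 79, 80]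

def key (c : List (ℕ × ℕ)) : ℕ :=
  c.foldr (fun p s => match Nat.beq p.1 3 || Nat.beq p.1 9 || Nat.beq p.1 8 with
    | true => 81 * s + p.2
    | false => s) 0

def leaves : List (List (ℕ × ℕ)) := search ord [[(1, 1), (0, 0)]]

theorem leaves_key : leaves.map key = [20420, 30382, 37428, 43988, 50062, 53220, 258632, 267865,
    270537, 513257, 523705, 527592] := by decide +kernel

theorem leaves_length : leaves.length = 12 := by
  have := congrArg List.length leaves_key
  simpa using this

theorem leaves_nodup : leaves.Nodup := by
  apply List.Nodup.of_map key
  rw [leaves_key]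
  decide

theorem bit_eq (m v : ℕ) : bit m v = m.testBit v := by
  have h : bit m v = Nat.beq ((m >>> v) &&& 1) 1 := rfl
  rw [h, Nat.testBit, Nat.and_comm, Nat.and_comm 1]
  rcases Nat.mod_two_eq_zero_or_one (m >>> v) with h | h <;> simp [Nat.and_one_is_mod, h] <;> rfl

theorem full_eq : (2417851639229258349412351 : ℕ) = 2 ^ 81 - 1 := by norm_num

theorem bit_full (w : ℕ) : bit 2417851639229258349412351 w = decide (w < 81) := by
  rw [bit_eq, full_eq, Nat.testBit_two_pow_sub_one]

theorem bit_land (a b w : ℕ) : bit (Nat.land a b) w = (bit a w && bit b w) := by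
  rw [bit_eq, bit_eq, bit_eq]; exact Nat.testBit_and a b w

theorem bit_msk (b : Bool) (x w : ℕ) (hw : w < 81) (hx : adj x x = false) :
    bit (msk b x) w = true ↔ w ≠ x ∧ adj x w = b := by
  cases b with
  | true =>
    simp only [msk, adj]
    constructor
    · intro h
      refine ⟨?_, h⟩
      rintro rfl
      rw [adj, h] at hx
      simp at hx
    · exact fun h => h.2
  | false =>
    simp only [msk]
    have e : bit (Nat.xor 2417851639229258349412351 (Nat.lor (row x) (Nat.shiftLeft 1 x))) w
        = ((decide (w < 81)) ^^ (adj x w || decide (x = w))) := by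
      have h2 : Nat.testBit (Nat.xor 2417851639229258349412351
        (Nat.lor (row x) (Nat.shiftLeft 1 x))) w = ((Nat.testBit 2417851639229258349412351 w) ^^
          ((row x).testBit w || (1 <<< x).testBit w)) := by
        rw [← Nat.testBit_or]; exact Nat.testBit_xor _ _ _
      rw [bit_eq, h2, ← bit_eq, bit_full, ← bit_eq, ← adj, Nat.one_shiftLeft, Nat.testBit_two_pow]
    rw [e]
    simp only [hw, decide_true, Bool.true_xor, Bool.not_eq_true', Bool.or_eq_false_iff,
      decide_eq_false_iff_not]
    constructor
    · rintro ⟨h1, h2⟩; exact ⟨fun h => h2 h.symm, h1⟩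
    · rintro ⟨h1, h2⟩; exact ⟨h2, fun h => h1 h.symm⟩

theorem bit_cand (r : ℕ) (c : List (ℕ × ℕ)) (m w : ℕ) :
    bit (cand r c m) w = true ↔
      bit m w = true ∧ ∀ p ∈ c, bit (msk (bit r p.1) p.2) w = true := by
  induction c generalizing m with
  | nil => simp [cand]
  | cons p c ih =>
    obtain ⟨u, x⟩ := p
    rw [cand, ih, bit_land]
    simp [and_assoc]

theorem mem_exts (v : ℕ) (c : List (ℕ × ℕ)) (m lo n : ℕ) (acc : List (List (ℕ × ℕ)))
    (d : List (ℕ × ℕ)) :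
    d ∈ exts v c m lo n acc ↔ d ∈ acc ∨ ∃ w < n, bit m w = true ∧ d = (v, lo + w) :: c := by
  induction n generalizing acc with
  | zero => simp [exts]
  | succ n ih =>
    rw [exts, ih]
    have key : (∃ w < n + 1, bit m w = true ∧ d = (v, lo + w) :: c) ↔
        (bit m n = true ∧ d = (v, lo + n) :: c) ∨
        ∃ w < n, bit m w = true ∧ d = (v, lo + w) :: c := by
      constructor
      · rintro ⟨w, hw, h⟩
        rcases Nat.lt_succ_iff_lt_or_eq.mp hw with h' | rfl
        · exact Or.inr ⟨w, h', h⟩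
        · exact Or.inl h
      · rintro (h | ⟨w, hw, h⟩)
        · exact ⟨n, by omega, h⟩
        · exact ⟨w, by omega, h⟩
    rw [key]
    cases hb : bit m n with
    | true =>
      simp only [List.mem_cons, true_and]
      change (d = (v, lo + n) :: c ∨ d ∈ acc) ∨ _ ↔ _
      tauto
    | false => simp

theorem bit_block (m j w : ℕ) (hw : w < 9) :
    bit (Nat.land (Nat.shiftRight m (Nat.mul 9 j)) 511) w = bit m (9 * j + w) := by
  rw [bit_land, bit_eq, bit_eq, bit_eq]
  have h1 : Nat.testBit 511 w = true := by
    rw [show (511 : ℕ) = 2 ^ 9 - 1 by norm_num, Nat.testBit_two_pow_sub_one]; simpa using hw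
  rw [h1, Bool.and_true]
  exact Nat.testBit_shiftRight (i := 9 * j) (j := w) m

theorem mem_extb (v : ℕ) (c : List (ℕ × ℕ)) (m j : ℕ) (acc : List (List (ℕ × ℕ)))
    (d : List (ℕ × ℕ)) :
    d ∈ extb v c m j acc ↔ d ∈ acc ∨ ∃ w < 9 * j, bit m w = true ∧ d = (v, w) :: c := by
  induction j generalizing acc with
  | zero => simp [extb]
  | succ j ih =>
    rw [extb, ih]
    have key : (∃ w < 9 * (j + 1), bit m w = true ∧ d = (v, w) :: c) ↔
        (∃ w < 9, bit (Nat.land (Nat.shiftRight m (Nat.mul 9 j)) 511) w = true ∧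
          d = (v, 9 * j + w) :: c) ∨
        ∃ w < 9 * j, bit m w = true ∧ d = (v, w) :: c := by
      constructor
      · rintro ⟨w, hw, h⟩
        rcases Nat.lt_or_ge w (9 * j) with h' | h'
        · exact Or.inr ⟨w, h', h⟩
        · refine Or.inl ⟨w - 9 * j, by omega, ?_⟩
          rw [bit_block _ _ _ (by omega), show 9 * j + (w - 9 * j) = w by omega]
          exact h
      · rintro (⟨w, hw, h⟩ | ⟨w, hw, h⟩)
        · rw [bit_block _ _ _ hw] at h
          exact ⟨9 * j + w, by omega, h⟩
        · exact ⟨w, by omega, h⟩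
    rw [key]
    generalize Nat.land (Nat.shiftRight m (Nat.mul 9 j)) 511 = k
    cases k with
    | zero =>
      have : ∀ w, bit 0 w = false := by intro w; rw [bit_eq]; simp
      simp [this]
    | succ k =>
      simp only
      rw [mem_exts]
      change (d ∈ acc ∨ ∃ w < 9, bit (k + 1) w = true ∧ d = (v, 9 * j + w) :: c) ∨ _ ↔ _
      rw [or_assoc]

theorem mem_step (v : ℕ) (L : List (List (ℕ × ℕ))) (d : List (ℕ × ℕ)) :
    d ∈ step v L ↔ ∃ c ∈ L, ∃ w < 81, (∀ p ∈ c, bit (msk (adj v p.1) p.2) w = true) ∧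
      d = (v, w) :: c := by
  induction L with
  | nil => simp [step]
  | cons c L ih =>
    rw [step, mem_extb, ih]
    simp only [bit_cand, bit_full, List.mem_cons, exists_eq_or_imp, adj]
    rw [or_comm]
    apply or_congr _ Iff.rfl
    constructor
    · rintro ⟨w, hw, ⟨_, h⟩, h'⟩; exact ⟨w, by omega, h, h'⟩
    · rintro ⟨w, hw, h, h'⟩; exact ⟨w, by omega, ⟨by simpa using hw, h⟩, h'⟩

/-- Code of the difference. -/
def sub (u v : ℕ) : ℕ :=
  (u % 3 + 2 * (v % 3)) % 3 + 3 * ((u / 3 % 3 + 2 * (v / 3 % 3)) % 3)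
    + 9 * ((u / 9 % 3 + 2 * (v / 9 % 3)) % 3) + 27 * ((u / 27 % 3 + 2 * (v / 27 % 3)) % 3)

theorem adj_sub : ∀ u < 81, ∀ v < 81, adj u v = bit conn (sub u v) := by decide +kernel

theorem adj_symm : ∀ u < 81, ∀ v < 81, adj u v = adj v u := by decide +kernel

theorem adj_irrefl : ∀ u < 81, adj u u = false := by decide +kernel

/-- Compatibility of two assignments. -/
def Compat (p q : ℕ × ℕ) : Prop := p.2 ≠ q.2 ∧ adj q.2 p.2 = adj p.1 q.1

def Good (l : List ℕ) (c : List (ℕ × ℕ)) : Prop :=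
  c.map Prod.fst = l ∧ (∀ p ∈ c, p.2 < 81) ∧ c.Pairwise Compat

theorem good_search (o l : List ℕ) (L : List (List (ℕ × ℕ))) (hL : ∀ c ∈ L, Good l c) :
    ∀ c ∈ search o L, Good (o.reverse ++ l) c := by
  induction o generalizing l L with
  | nil => simpa [search] using hL
  | cons v o ih =>
    have := ih (v :: l) (step v L) ?_
    · simpa [search] using this
    · intro d hd
      obtain ⟨c, hc, w, hw, h, rfl⟩ := (mem_step _ _ _).1 hd
      obtain ⟨h1, h2, h3⟩ := hL c hc
      refine ⟨by simp [h1], ?_, ?_⟩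
      · intro p hp
        rcases List.mem_cons.1 hp with rfl | hp
        · exact hw
        · exact h2 p hp
      · refine List.pairwise_cons.2 ⟨?_, h3⟩
        intro p hp
        exact (bit_msk _ _ _ hw (adj_irrefl _ (h2 p hp))).1 (h p hp)

theorem mem_search (f : ℕ → ℕ) (hf : ∀ u < 81, f u < 81)
    (hinj : ∀ u < 81, ∀ v < 81, u ≠ v → f u ≠ f v)
    (hadj : ∀ u < 81, ∀ v < 81, adj (f u) (f v) = adj u v)
    (o l : List ℕ) (hnd : (o.reverse ++ l).Nodup) (hlt : ∀ u ∈ o.reverse ++ l, u < 81)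
    (L : List (List (ℕ × ℕ))) (hL : l.map (fun v => (v, f v)) ∈ L) :
    (o.reverse ++ l).map (fun v => (v, f v)) ∈ search o L := by
  induction o generalizing l L with
  | nil => simpa [search] using hL
  | cons v o ih =>
    have e : (v :: o).reverse ++ l = o.reverse ++ (v :: l) := by simp
    rw [e] at hnd hlt ⊢
    rw [search]
    apply ih _ hnd hlt
    rw [mem_step]
    have hv : v < 81 := hlt v (by simp)
    refine ⟨_, hL, f v, hf v hv, ?_, by simp⟩
    intro p hp
    obtain ⟨u, hu, rfl⟩ := List.mem_map.1 hp
    have hu' : u < 81 := hlt u (by simp [hu])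
    have hne : v ≠ u := by
      rintro rfl
      have := (List.nodup_append.1 hnd).2.1
      exact (List.nodup_cons.1 this).1 hu
    rw [bit_msk _ _ _ (hf v hv) (adj_irrefl _ (hf u hu'))]
    refine ⟨hinj v hv u hu' hne, ?_⟩
    rw [hadj u hu' v hv, adj_symm u hu' v hv]

/-- All vertices in order of decreasing search depth. -/
def allv : List ℕ := ord.reverse ++ [1, 0]

theorem allv_nodup : allv.Nodup := by decide +kernel
theorem allv_lt : ∀ u ∈ allv, u < 81 := by decide +kernel
theorem mem_allv : ∀ u < 81, u ∈ allv := by decide +kernel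

/-- Extension of a permutation of `Fin 81` to the naturals. -/
def ext (τ : Equiv.Perm (Fin 81)) (v : ℕ) : ℕ := if h : v < 81 then (τ ⟨v, h⟩ : ℕ) else 0

theorem ext_val (τ : Equiv.Perm (Fin 81)) (v : Fin 81) : ext τ v = τ v := by simp [ext]

def Stab : Set (Equiv.Perm (Fin 81)) :=
  {τ | (∀ u v : Fin 81, adj (τ u) (τ v) = adj u v) ∧ τ 0 = 0 ∧ τ 1 = 1}

def toL (τ : Equiv.Perm (Fin 81)) : List (ℕ × ℕ) := allv.map (fun v => (v, ext τ v))

theorem toL_inj : Function.Injective toL := by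
  intro σ τ h
  ext v
  have := List.map_inj_left.1 h v (mem_allv v v.2)
  simp only [Prod.mk.injEq, true_and, ext_val] at this
  exact this

theorem toL_image : toL '' Stab = {c | c ∈ leaves} := by
  ext c
  simp only [Set.mem_image, Set.mem_ofPred_eq]
  constructor
  · rintro ⟨τ, ⟨h1, h2, h3⟩, rfl⟩
    apply mem_search
    · intro u hu; simp [ext, hu]
    · intro u hu v hv huv
      simp only [ext, hu, hv, dite_true]
      intro h
      apply huv
      have := τ.injective (Fin.ext h)
      simpa using this
    · intro u hu v hv
      simp only [ext, hu, hv, dite_true]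
      exact h1 ⟨u, hu⟩ ⟨v, hv⟩
    · exact allv_nodup
    · exact allv_lt
    · have e0 : ext τ 0 = 0 := by
        have := ext_val τ 0
        rw [h2] at this; simpa using this
      have e1 : ext τ 1 = 1 := by
        have := ext_val τ 1
        rw [h3] at this; simpa using this
      simp [e0, e1]
  · intro hc
    have hg : Good allv c := by
      apply good_search ord [1, 0] _ _ c hc
      intro d hd
      rw [List.mem_singleton] at hd
      subst hd
      refine ⟨rfl, by simp, ?_⟩
      simp only [List.pairwise_cons, List.mem_singleton, forall_eq, List.not_mem_nil]
      refine ⟨⟨by decide, ?_⟩, by simp⟩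
      exact adj_symm _ (by norm_num) _ (by norm_num)
    obtain ⟨h1, h2, h3⟩ := hg
    have hnd : (c.map Prod.fst).Nodup := h1 ▸ allv_nodup
    have hex : ∀ v : Fin 81, ∃ w : Fin 81, ((v : ℕ), (w : ℕ)) ∈ c := by
      intro v
      have : (v : ℕ) ∈ c.map Prod.fst := h1 ▸ mem_allv v v.2
      obtain ⟨⟨a, b⟩, hp, hp'⟩ := List.mem_map.1 this
      simp only at hp'
      subst hp'
      exact ⟨⟨b, h2 _ hp⟩, hp⟩
    choose f hf using hex
    have hfst : ∀ p ∈ c, p.1 < 81 := by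
      intro p hp
      apply allv_lt
      rw [← h1]
      exact List.mem_map_of_mem hp
    have hun : ∀ p ∈ c, ∀ q ∈ c, p.1 = q.1 → p = q := by
      intro p hp q hq h
      exact List.inj_on_of_nodup_map hnd hp hq h
    have hcomp : ∀ p ∈ c, ∀ q ∈ c, p ≠ q → Compat p q := by
      have : ∀ p ∈ c, ∀ q ∈ c, p ≠ q → Compat p q ∨ Compat q p := by
        intro p hp q hq hpq
        have h4 : c.Pairwise (fun p q => Compat p q ∨ Compat q p) := h3.imp Or.inl
        have : Std.Symm (fun p q => Compat p q ∨ Compat q p) := ⟨fun _ _ => Or.symm⟩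
        exact h4.forall hp hq hpq
      intro p hp q hq hpq
      rcases this p hp q hq hpq with h | h
      · exact h
      · refine ⟨h.1.symm, ?_⟩
        rw [adj_symm _ (h2 _ hq) _ (h2 _ hp), adj_symm _ (hfst _ hp) _ (hfst _ hq)]
        exact h.2
    have hne : ∀ u v : Fin 81, u ≠ v → ((u : ℕ), (f u : ℕ)) ≠ ((v : ℕ), (f v : ℕ)) := by
      intro u v huv h
      exact huv (Fin.ext (Prod.ext_iff.1 h).1)
    have finj : Function.Injective f := by
      intro u v h
      by_contra huv
      exact (hcomp _ (hf u) _ (hf v) (hne u v huv)).1 (by simp [h])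
    have hbase : ∀ d ∈ leaves, ((0, 0) : ℕ × ℕ) ∈ d ∧ ((1, 1) : ℕ × ℕ) ∈ d := by
      have gen : ∀ (o : List ℕ) (L : List (List (ℕ × ℕ))),
          (∀ d ∈ L, ((0, 0) : ℕ × ℕ) ∈ d ∧ ((1, 1) : ℕ × ℕ) ∈ d) →
          ∀ d ∈ search o L, ((0, 0) : ℕ × ℕ) ∈ d ∧ ((1, 1) : ℕ × ℕ) ∈ d := by
        intro o
        induction o with
        | nil => intro L h; simpa [search] using h
        | cons v o ih =>
          intro L h
          rw [search]
          apply ih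
          intro d hd
          obtain ⟨c, hc, w, hw, -, rfl⟩ := (mem_step _ _ _).1 hd
          exact ⟨List.mem_cons_of_mem _ (h c hc).1, List.mem_cons_of_mem _ (h c hc).2⟩
      apply gen
      intro d hd
      rw [List.mem_singleton] at hd
      subst hd
      simp
    refine ⟨Equiv.ofBijective f (Finite.injective_iff_bijective.1 finj), ⟨?_, ?_, ?_⟩, ?_⟩
    · intro u v
      simp only [Equiv.ofBijective_apply]
      by_cases huv : u = v
      · subst huv
        rw [adj_irrefl _ u.2, adj_irrefl _ (f u).2]
      · have := (hcomp _ (hf v) _ (hf u) (hne v u (Ne.symm huv))).2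
        simp only at this
        rw [this, adj_symm _ v.2 _ u.2]
    · simp only [Equiv.ofBijective_apply]
      have := hun _ (hf 0) _ (hbase c hc).1 rfl
      exact Fin.ext (Prod.ext_iff.1 this).2
    · simp only [Equiv.ofBijective_apply]
      have := hun _ (hf 1) _ (hbase c hc).2 rfl
      exact Fin.ext (Prod.ext_iff.1 this).2
    · rw [toL, ← h1, List.map_map]
      conv_rhs => rw [← List.map_id c]
      apply List.map_congr_left
      intro p hp
      have := hun _ (hf ⟨p.1, hfst p hp⟩) _ hp rfl
      simp only [Function.comp, id, ext, hfst p hp, dite_true, Equiv.ofBijective_apply]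
      exact this

theorem stab_ncard : Stab.ncard = 12 := by
  rw [← Set.ncard_image_of_injective _ toL_inj, toL_image]
  have : {c | c ∈ leaves} = ((leaves.toFinset : Finset _) : Set (List (ℕ × ℕ))) := by
    ext; simp
  rw [this, Set.ncard_coe_finset, List.toFinset_card_of_nodup leaves_nodup, leaves_length]

theorem pow40 {R : Type*} [CommRing R] (h3 : (3 : R) = 0) (r : R) (h4 : r ^ 4 = 2 * r + 1) :
    r ^ 40 = 2 := by
  have h5 : r ^ 5 = r + 2 * r ^ 2 := by linear_combination r * h4
  have h10 : r ^ 10 = 1 + 2 * r + r ^ 2 + r ^ 3 := by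
    linear_combination (r ^ 5 + (r + 2 * r ^ 2)) * h5 + 4 * h4 + (1 + 2 * r + r ^ 3) * h3
  have h20 : r ^ 20 = r + 2 * r ^ 2 + 2 * r ^ 3 := by
    linear_combination (r ^ 10 + (1 + 2 * r + r ^ 2 + r ^ 3)) * h10 + (5 + 2 * r + r ^ 2) * h4
      + (2 + 5 * r + 3 * r ^ 2 + 2 * r ^ 3) * h3
  linear_combination (r ^ 20 + (r + 2 * r ^ 2 + 2 * r ^ 3)) * h20 + (8 + 8 * r + 4 * r ^ 2) * h4
      + (2 + 8 * r + 7 * r ^ 2 + 4 * r ^ 3) * h3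

theorem pow80 {R : Type*} [CommRing R] (h3 : (3 : R) = 0) (r : R) (h4 : r ^ 4 = 2 * r + 1) :
    r ^ 80 = 1 := by
  have h40 := pow40 h3 r h4
  linear_combination (r ^ 40 + 2) * h40 + h3

theorem exists_root (F : Type*) [Field F] [Fintype F] (hF : Fintype.card F = 81)
    (h3 : (3 : F) = 0) : ∃ a : F, a ^ 4 = 2 * a + 1 := by
  classical
  let P : Polynomial F := Polynomial.X ^ 4 - (Polynomial.C 2 * Polynomial.X + Polynomial.C 1)
  have hdeg : P.degree = 4 := by
    simp only [P]
    compute_degree!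
  have hdvd : P ∣ Polynomial.X ^ 81 - Polynomial.X := by
    rw [← AdjoinRoot.mk_eq_zero]
    have h3' : (3 : AdjoinRoot P) = 0 := by
      have := congrArg (AdjoinRoot.of P) h3
      rwa [map_ofNat, map_zero] at this
    have hr : (AdjoinRoot.mk P Polynomial.X) ^ 4 = 2 * (AdjoinRoot.mk P Polynomial.X) + 1 := by
      have h := AdjoinRoot.mk_self (f := P)
      have e : AdjoinRoot.mk P P = (AdjoinRoot.mk P Polynomial.X) ^ 4
          - (2 * (AdjoinRoot.mk P Polynomial.X) + 1) := by
        have e2 : P = Polynomial.X ^ 4 - (2 * Polynomial.X + 1) := rfl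
        refine (congrArg (AdjoinRoot.mk P) e2).trans ?_
        simp only [map_sub, map_add, map_mul, map_pow, map_one, map_ofNat]
      rw [e] at h
      exact sub_eq_zero.1 h
    have h80 := pow80 h3' _ hr
    rw [map_sub, map_pow, pow_succ, h80, one_mul, sub_self]
  have hs : (Polynomial.X ^ 81 - Polynomial.X : Polynomial F).Splits := by
    have := Polynomial.splits_X_pow_nat_card_sub_X (K := F)
    rwa [Nat.card_eq_fintype_card, hF] at this
  have hne : (Polynomial.X ^ 81 - Polynomial.X : Polynomial F) ≠ 0 :=
    FiniteField.X_pow_card_sub_X_ne_zero F (by norm_num)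
  obtain ⟨a, ha⟩ := (hs.of_dvd hne hdvd).exists_eval_eq_zero (by rw [hdeg]; decide)
  refine ⟨a, ?_⟩
  simp only [P, Polynomial.eval_sub, Polynomial.eval_add, Polynomial.eval_mul, Polynomial.eval_pow,
    Polynomial.eval_X, Polynomial.eval_C] at ha
  exact sub_eq_zero.1 ha

section field

variable {F : Type*} [Field F]

theorem two_ne_one : (2 : F) ≠ 1 := by
  intro h
  have : (1 : F) = 0 := by linear_combination h
  exact one_ne_zero this

theorem root_ne_zero {a : F} (h4 : a ^ 4 = 2 * a + 1) : a ≠ 0 := by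
  rintro rfl
  norm_num at h4

theorem order_root (h3 : (3 : F) = 0) {a : F} (h4 : a ^ 4 = 2 * a + 1) : orderOf a = 80 := by
  apply orderOf_eq_of_pow_and_pow_div_prime (by norm_num) (pow80 h3 a h4)
  intro p hp hd
  have h40 := pow40 h3 a h4
  have hp' : p = 2 ∨ p = 5 := by
    rw [show 80 = 2 ^ 4 * 5 by norm_num, hp.dvd_mul] at hd
    rcases hd with hd | hd
    · left; exact (Nat.prime_dvd_prime_iff_eq hp Nat.prime_two).1 (hp.dvd_of_dvd_pow hd)
    · right; exact (Nat.prime_dvd_prime_iff_eq hp Nat.prime_five).1 hd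
  rcases hp' with rfl | rfl
  · norm_num
    rw [h40]
    exact two_ne_one
  · norm_num
    intro h16
    have ha := root_ne_zero h4
    have h8 : a ^ 8 = 2 := by linear_combination h40 - a ^ 8 * (a ^ 16 + 1) * h16
    have hq : a ^ 2 = 2 * a + 1 := by
      linear_combination h8 - (a ^ 4 + (2 * a + 1)) * h4 - (a ^ 2 + 2 * a) * h3
    have h1 : a ^ 2 * (a ^ 2 - 1) = 0 := by linear_combination h4 - hq
    have h2 : a ^ 2 = 1 := by
      rcases mul_eq_zero.1 h1 with h | h
      · exact absurd h (pow_ne_zero 2 ha)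
      · exact sub_eq_zero.1 h
    apply ha
    linear_combination (-2 : F) * hq + 2 * h2 - a * h3

/-- The quartic-residue form of the connection set. -/
def Q (i z : F) : Prop := z ^ 20 = 1 ∨ z ^ 20 = i

theorem adj_iff [Fintype F] (hF : Fintype.card F = 81) (ω : Fˣ)
    (hω : ∀ x : Fˣ, x ∈ Subgroup.zpowers ω) (x y : F) :
    peisertAdj ω x y ↔ Q ((ω : F) ^ 20) (x - y) := by
  have hcard : Nat.card Fˣ = 80 := by
    rw [Nat.card_units, Nat.card_eq_fintype_card, hF]
  have hord : orderOf ω = 80 := by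
    rw [orderOf_eq_card_of_forall_mem_zpowers hω, hcard]
  have hp : ∀ c : Fˣ, c ∈ Subgroup.zpowers (ω ^ 4) ↔ c ^ 20 = 1 := by
    intro c
    constructor
    · rintro ⟨n, rfl⟩
      simp only
      rw [← zpow_natCast, ← zpow_mul, ← zpow_natCast, ← zpow_mul, ← orderOf_dvd_iff_zpow_eq_one,
        hord]
      exact ⟨n, by push_cast; ring⟩
    · intro h
      obtain ⟨n, rfl⟩ := hω c
      simp only at h ⊢
      rw [← zpow_natCast, ← zpow_mul, ← orderOf_dvd_iff_zpow_eq_one, hord] at h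
      have : (4 : ℤ) ∣ n := by push_cast at h; omega
      obtain ⟨m, rfl⟩ := this
      refine ⟨m, ?_⟩
      simp only
      rw [← zpow_natCast, ← zpow_mul]
      norm_num
  constructor
  · rintro ⟨_, c, hc, h⟩
    rw [hp] at hc
    have hc' : (c : F) ^ 20 = 1 := by
      rw [← Units.val_pow_eq_pow_val, hc, Units.val_one]
    rcases h with h | h
    · left; rw [h, hc']
    · right; rw [h, mul_pow, hc', mul_one]
  · intro h
    have hz : x - y ≠ 0 := by
      intro hz
      rw [hz] at h
      rcases h with h | h
      · norm_num at h
      · have : (ω : F) ^ 20 ≠ 0 := pow_ne_zero _ ω.ne_zero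
        rw [← h] at this
        norm_num at this
    refine ⟨sub_ne_zero.1 hz, ?_⟩
    rcases h with h | h
    · refine ⟨Units.mk0 _ hz, ?_, Or.inl rfl⟩
      rw [hp]
      ext
      simpa using h
    · refine ⟨ω⁻¹ * Units.mk0 _ hz, ?_, Or.inr ?_⟩
      · rw [hp]
        ext
        simp only [Units.val_pow_eq_pow_val, Units.val_mul, Units.val_mk0, mul_pow, h,
          Units.val_one, Units.val_inv_eq_inv_val]
        rw [← mul_pow, inv_mul_cancel₀ ω.ne_zero, one_pow]
      · simp

theorem exists_good_root [Fintype F] (hF : Fintype.card F = 81) (h3 : (3 : F) = 0) (ω : Fˣ)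
    (hω : ∀ x : Fˣ, x ∈ Subgroup.zpowers ω) :
    ∃ a : F, a ^ 4 = 2 * a + 1 ∧ (ω : F) ^ 20 = a ^ 20 := by
  obtain ⟨a, h4⟩ := exists_root F hF h3
  have hcard : Nat.card Fˣ = 80 := by
    rw [Nat.card_units, Nat.card_eq_fintype_card, hF]
  have hord : orderOf (ω : F) = 80 := by
    rw [orderOf_units, orderOf_eq_card_of_forall_mem_zpowers hω, hcard]
  have h80 : (ω : F) ^ 80 = 1 := by rw [← hord]; exact pow_orderOf_eq_one _
  have h40 : (ω : F) ^ 40 = 2 := by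
    have h1 : ((ω : F) ^ 40 - 1) * ((ω : F) ^ 40 + 1) = 0 := by linear_combination h80
    rcases mul_eq_zero.1 h1 with h | h
    · have := orderOf_dvd_of_pow_eq_one (sub_eq_zero.1 h)
      rw [hord] at this
      norm_num at this
    · linear_combination h - h3
  have ha := pow40 h3 a h4
  have h1 : ((ω : F) ^ 20 - a ^ 20) * ((ω : F) ^ 20 + a ^ 20) = 0 := by
    linear_combination h40 - ha
  rcases mul_eq_zero.1 h1 with h | h
  · exact ⟨a, h4, sub_eq_zero.1 h⟩
  · refine ⟨a ^ 3, ?_, ?_⟩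
    · linear_combination (a ^ 8 + a ^ 4 * (2 * a + 1) + (2 * a + 1) ^ 2) * h4
        + (2 * a ^ 3 + 4 * a ^ 2 + 2 * a) * h3
    · linear_combination h - a ^ 20 * ha - a ^ 20 * h3

end field

/-- Multiplication by the primitive element on codes. -/
def mula (n : ℕ) : ℕ :=
  n / 27 % 3 + 3 * ((n % 3 + 2 * (n / 27 % 3)) % 3) + 9 * (n / 3 % 3) + 27 * (n / 9 % 3)

/-- Codes of the powers of the primitive element. -/
def pw : ℕ → ℕ
  | 0 => 1
  | k + 1 => mula (pw k)

theorem pw_conn : ∀ k < 80, bit conn (pw k) = Nat.blt (k % 4) 2 := by decide +kernel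

theorem pw_surj : ∀ n < 81, n ≠ 0 → ∃ k < 80, pw k = n := by decide +kernel

theorem pw_lt : ∀ k < 80, pw k < 81 := by decide +kernel

theorem conn_zero : bit conn 0 = false := by decide +kernel

theorem conn_card : (Finset.univ.filter (fun n : Fin 81 => bit conn n = true)).card = 40 := by
  decide +kernel

theorem sub_lt (u v : ℕ) : sub u v < 81 := by unfold sub; omega

theorem sub_eq_zero_iff : ∀ u < 81, ∀ v < 81, sub u v = 0 → u = v := by
  decide +kernel

section field2

variable {F : Type*} [Field F]

/-- Decoding. -/
def phi (a : F) (n : ℕ) : F :=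
  ((n % 3 : ℕ) : F) + ((n / 3 % 3 : ℕ) : F) * a + ((n / 9 % 3 : ℕ) : F) * a ^ 2
    + ((n / 27 % 3 : ℕ) : F) * a ^ 3

theorem cast_mod (h3 : (3 : F) = 0) (n : ℕ) : ((n % 3 : ℕ) : F) = n := by
  conv_rhs => rw [← Nat.mod_add_div n 3]
  push_cast
  rw [h3]; ring

theorem phi_digits (a : F) (p q r s : ℕ) (hp : p < 3) (hq : q < 3) (hr : r < 3) (hs : s < 3) :
    phi a (p + 3 * q + 9 * r + 27 * s) = (p : F) + q * a + r * a ^ 2 + s * a ^ 3 := by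
  unfold phi
  rw [show (p + 3 * q + 9 * r + 27 * s) % 3 = p by omega,
    show (p + 3 * q + 9 * r + 27 * s) / 3 % 3 = q by omega,
    show (p + 3 * q + 9 * r + 27 * s) / 9 % 3 = r by omega,
    show (p + 3 * q + 9 * r + 27 * s) / 27 % 3 = s by omega]

theorem phi_sub (h3 : (3 : F) = 0) (a : F) (u v : ℕ) : phi a (sub u v) = phi a u - phi a v := by
  unfold sub
  rw [phi_digits a _ _ _ _ (Nat.mod_lt _ (by norm_num)) (Nat.mod_lt _ (by norm_num))
    (Nat.mod_lt _ (by norm_num)) (Nat.mod_lt _ (by norm_num))]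
  simp only [cast_mod h3, phi, Nat.cast_add, Nat.cast_mul, Nat.cast_ofNat]
  linear_combination ((v : F) + ((v / 3 : ℕ) : F) * a + ((v / 9 : ℕ) : F) * a ^ 2
    + ((v / 27 : ℕ) : F) * a ^ 3) * h3

theorem phi_mula (h3 : (3 : F) = 0) (a : F) (h4 : a ^ 4 = 2 * a + 1) (n : ℕ) :
    phi a (mula n) = a * phi a n := by
  unfold mula
  rw [phi_digits a _ _ _ _ (Nat.mod_lt _ (by norm_num)) (Nat.mod_lt _ (by norm_num))
    (Nat.mod_lt _ (by norm_num)) (Nat.mod_lt _ (by norm_num))]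
  simp only [cast_mod h3, phi, Nat.cast_add, Nat.cast_mul, Nat.cast_ofNat]
  linear_combination (-((n / 27 : ℕ) : F)) * h4

theorem phi_pw (h3 : (3 : F) = 0) (a : F) (h4 : a ^ 4 = 2 * a + 1) (k : ℕ) :
    phi a (pw k) = a ^ k := by
  induction k with
  | zero => simp [pw, phi]
  | succ k ih => rw [pw, phi_mula h3 a h4, ih, pow_succ']

theorem phi_zero (a : F) : phi a 0 = 0 := by simp [phi]
theorem phi_one (a : F) : phi a 1 = 1 := by simp [phi]

theorem Q_zero {i : F} (hi : i ≠ 0) : ¬ Q i 0 := by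
  rintro (h | h)
  · norm_num at h
  · apply hi; rw [← h]; norm_num

theorem Q_phi (h3 : (3 : F) = 0) (a : F) (h4 : a ^ 4 = 2 * a + 1) (n : ℕ) (hn : n < 81) :
    Q (a ^ 20) (phi a n) ↔ bit conn n = true := by
  by_cases h0 : n = 0
  · subst h0
    rw [phi_zero, conn_zero]
    simp only [Bool.false_eq_true, iff_false]
    exact Q_zero (pow_ne_zero _ (root_ne_zero h4))
  · obtain ⟨k, hk, rfl⟩ := pw_surj n hn h0
    rw [phi_pw h3 a h4, pw_conn k hk, Q]
    have ho := order_root h3 h4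
    have e1 : (a ^ k) ^ 20 = 1 ↔ k % 4 = 0 := by
      rw [← pow_mul, ← orderOf_dvd_iff_pow_eq_one, ho]; omega
    have e2 : (a ^ k) ^ 20 = a ^ 20 ↔ k % 4 = 1 := by
      rw [← pow_mul]
      have hu : IsUnit a := (root_ne_zero h4).isUnit
      obtain ⟨b, rfl⟩ := hu
      rw [orderOf_units] at ho
      rw [← Units.val_pow_eq_pow_val, ← Units.val_pow_eq_pow_val, Units.val_inj,
        pow_eq_pow_iff_modEq, ho, Nat.ModEq]
      omega
    rw [e1, e2, Nat.blt_eq]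
    omega

theorem phi_bij [Fintype F] (hF : Fintype.card F = 81) (h3 : (3 : F) = 0) (a : F)
    (h4 : a ^ 4 = 2 * a + 1) : Function.Bijective (fun n : Fin 81 => phi a n) := by
  rw [Fintype.bijective_iff_injective_and_card]
  refine ⟨?_, by rw [hF, Fintype.card_fin]⟩
  intro u v h
  apply Fin.ext
  apply sub_eq_zero_iff _ u.2 _ v.2
  by_contra hne
  have h0 : phi a (sub u v) = 0 := by rw [phi_sub h3]; exact sub_eq_zero.2 h
  obtain ⟨k, hk, hk'⟩ := pw_surj _ (sub_lt u v) hne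
  rw [← hk', phi_pw h3 a h4] at h0
  exact pow_ne_zero _ (root_ne_zero h4) h0

/-- Being an automorphism. -/
def IsAut (i : F) (σ : Equiv.Perm F) : Prop := ∀ x y, Q i (x - y) ↔ Q i (σ x - σ y)

theorem stabF [Fintype F] (hF : Fintype.card F = 81) (h3 : (3 : F) = 0) (a : F)
    (h4 : a ^ 4 = 2 * a + 1) :
    {σ : Equiv.Perm F | IsAut (a ^ 20) σ ∧ σ 0 = 0 ∧ σ 1 = 1}.ncard = 12 := by
  let e : Fin 81 ≃ F := Equiv.ofBijective _ (phi_bij hF h3 a h4)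
  have he : ∀ n : Fin 81, e n = phi a n := fun n => rfl
  have e0 : e 0 = 0 := by rw [he]; exact phi_zero a
  have e1 : e 1 = 1 := by rw [he]; exact phi_one a
  have hadj : ∀ u v : Fin 81, Q (a ^ 20) (e u - e v) ↔ adj u v = true := by
    intro u v
    rw [he, he, ← phi_sub h3, Q_phi h3 a h4 _ (sub_lt _ _), adj_sub _ u.2 _ v.2]
  rw [← stab_ncard, ← Set.ncard_image_of_injective Stab (e.permCongr).injective]
  congr 1
  ext σ
  simp only [Set.mem_image, Set.mem_ofPred_eq]
  constructor
  · rintro ⟨h, h0, h1⟩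
    refine ⟨e.permCongr.symm σ, ⟨?_, ?_, ?_⟩, Equiv.apply_symm_apply _ _⟩
    · intro u v
      rw [Bool.eq_iff_iff, ← hadj, ← hadj, h (e u) (e v)]
      simp
    · simp only [Equiv.permCongr_symm_apply, e0, h0]
      rw [← e0, Equiv.symm_apply_apply]
    · simp only [Equiv.permCongr_symm_apply, e1, h1]
      rw [← e1, Equiv.symm_apply_apply]
  · rintro ⟨τ, ⟨h, h0, h1⟩, rfl⟩
    refine ⟨?_, ?_, ?_⟩
    · intro x y
      obtain ⟨u, rfl⟩ := e.surjective x
      obtain ⟨v, rfl⟩ := e.surjective y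
      simp only [Equiv.permCongr_apply, Equiv.symm_apply_apply]
      rw [hadj, hadj, h]
    · rw [Equiv.permCongr_apply, e.symm_apply_eq.2 e0.symm, h0, e0]
    · rw [Equiv.permCongr_apply, e.symm_apply_eq.2 e1.symm, h1, e1]

theorem Q_card [Fintype F] [DecidableEq F] [DecidablePred (Q (F := F) i)]
    (hF : Fintype.card F = 81) (h3 : (3 : F) = 0) (a : F) (h4 : a ^ 4 = 2 * a + 1)
    (hi : i = a ^ 20) : (Finset.univ.filter (fun z : F => Q i z)).card = 40 := by
  subst hi
  let e : Fin 81 ≃ F := Equiv.ofBijective _ (phi_bij hF h3 a h4)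
  rw [← conn_card]
  symm
  apply Finset.card_equiv e
  intro n
  simp only [Finset.mem_filter, Finset.mem_univ, true_and]
  exact (Q_phi h3 a h4 n n.2).symm

theorem cube_inj (h3 : (3 : F) = 0) {x y : F} (h : x ^ 3 = y ^ 3) : x = y := by
  have : (x - y) ^ 3 = 0 := by linear_combination h + (-x ^ 2 * y + x * y ^ 2) * h3
  exact sub_eq_zero.1 (pow_eq_zero_iff (by norm_num) |>.1 this)

theorem exists_aut [Finite F] (h3 : (3 : F) = 0) {i : F} (hi : i ^ 2 = 2) (x y : F)
    (hxy : Q i (x - y)) : ∃ g : Equiv.Perm F, IsAut i g ∧ g 0 = y ∧ g 1 = x := by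
  have hi0 : i ≠ 0 := by
    rintro rfl
    have : (1 : F) = 0 := by linear_combination hi + h3
    exact one_ne_zero this
  have hi4 : i ^ 4 = 1 := by linear_combination (i ^ 2 + 2) * hi + h3
  have hc : x - y ≠ 0 := by
    intro h
    rw [h] at hxy
    exact Q_zero hi0 hxy
  rcases hxy with h | h
  · have hinj : Function.Injective (fun z : F => (x - y) * z + y) := by
      intro u v huv
      simp only [add_left_inj] at huv
      exact mul_left_cancel₀ hc huv
    refine ⟨Equiv.ofBijective _ (Finite.injective_iff_bijective.1 hinj), ?_, by simp, by simp⟩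
    intro u v
    simp only [Equiv.ofBijective_apply, Q]
    rw [show (x - y) * u + y - ((x - y) * v + y) = (x - y) * (u - v) by ring, mul_pow, h, one_mul]
  · have hinj : Function.Injective (fun z : F => (x - y) * z ^ 3 + y) := by
      intro u v huv
      simp only [add_left_inj] at huv
      exact cube_inj h3 (mul_left_cancel₀ hc huv)
    refine ⟨Equiv.ofBijective _ (Finite.injective_iff_bijective.1 hinj), ?_, by simp, by simp⟩
    intro u v
    simp only [Equiv.ofBijective_apply, Q]
    have e : (x - y) * u ^ 3 + y - ((x - y) * v ^ 3 + y) = (x - y) * (u - v) ^ 3 := by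
      linear_combination ((x - y) * (u ^ 2 * v - u * v ^ 2)) * h3
    rw [e, mul_pow, h, ← pow_mul, mul_comm 3 20, pow_mul]
    generalize (u - v) ^ 20 = t
    constructor
    · rintro (rfl | rfl)
      · right; ring
      · left; linear_combination hi4
    · rintro (h' | h')
      · right
        apply cube_inj h3
        apply mul_left_cancel₀ hi0
        linear_combination h' - hi4
      · left
        apply cube_inj h3
        apply mul_left_cancel₀ hi0
        linear_combination h'

theorem main_count [Fintype F] (hF : Fintype.card F = 81) (h3 : (3 : F) = 0) (a : F)
    (h4 : a ^ 4 = 2 * a + 1) : {σ : Equiv.Perm F | IsAut (a ^ 20) σ}.ncard = 38880 := by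
  classical
  have hi : (a ^ 20) ^ 2 = 2 := by rw [← pow_mul]; exact pow40 h3 a h4
  generalize hia : a ^ 20 = i at hi
  have hstab := stabF hF h3 a h4
  rw [hia] at hstab
  let A : Finset (Equiv.Perm F) := Finset.univ.filter (IsAut i)
  let T : Finset (F × F) := Finset.univ.filter (fun p => Q i (p.2 - p.1))
  have hA : {σ : Equiv.Perm F | IsAut i σ}.ncard = A.card := by
    rw [← Set.ncard_coe_finset]; congr 1; ext; simp [A]
  have hmaps : Set.MapsTo (fun σ : Equiv.Perm F => (σ 0, σ 1)) A T := by
    intro σ hσ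
    have hσ' : IsAut i σ := by simpa [A] using hσ
    have : Q i (σ 1 - σ 0) := by
      rw [← hσ' 1 0, sub_zero]; left; norm_num
    simpa [T] using this
  have hfib : ∀ p ∈ T, (A.filter (fun σ => (σ 0, σ 1) = p)).card = 12 := by
    rintro ⟨y, x⟩ hp
    have hq : Q i (x - y) := by simpa [T] using hp
    obtain ⟨g, hg, g0, g1⟩ := exists_aut h3 hi x y hq
    rw [← hstab, ← Set.ncard_image_of_injective _ (mul_right_injective g), ← Set.ncard_coe_finset]
    congr 1
    ext σ
    simp only [Finset.coe_filter, Set.mem_ofPred_eq, Set.mem_image, A, Finset.mem_filter,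
      Finset.mem_univ, true_and, Prod.mk.injEq]
    constructor
    · rintro ⟨h, h0, h1⟩
      refine ⟨g⁻¹ * σ, ⟨?_, ?_, ?_⟩, by simp⟩
      · intro u v
        rw [h u v, hg ((g⁻¹ * σ) u) ((g⁻¹ * σ) v)]
        simp
      · rw [Equiv.Perm.mul_apply, h0, ← g0]; exact g.symm_apply_apply 0
      · rw [Equiv.Perm.mul_apply, h1, ← g1]; exact g.symm_apply_apply 1
    · rintro ⟨τ, ⟨h, h0, h1⟩, rfl⟩
      refine ⟨?_, ?_, ?_⟩
      · intro u v
        rw [h u v, hg (τ u) (τ v)]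
        rfl
      · rw [Equiv.Perm.mul_apply, h0, g0]
      · rw [Equiv.Perm.mul_apply, h1, g1]
  have hT : T.card = 81 * 40 := by
    have : T.card = (Finset.univ ×ˢ (Finset.univ.filter (fun z : F => Q i z)) :
        Finset (F × F)).card := by
      apply Finset.card_bij' (fun p _ => (p.1, p.2 - p.1)) (fun p _ => (p.1, p.2 + p.1))
      · intro p _; simp
      · intro p _; simp
      · intro p hp; simpa [T] using hp
      · intro p hp; simpa [T] using hp
    rw [this, Finset.card_product, Finset.card_univ, hF, Q_card hF h3 a h4 hia.symm]
  rw [hA, Finset.card_eq_sum_card_fiberwise hmaps, Finset.sum_congr rfl hfib, Finset.sum_const, hT]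
  norm_num

end field2

end Peisert81

/-- The automorphism group of the Peisert graph on `GF(81)`
has order `38880`. -/
theorem peisert81_aut_card
    (F : Type*) [Field F] [Fintype F] (hF : Fintype.card F = 81)
    (ω : Fˣ) (hω : ∀ x : Fˣ, x ∈ Subgroup.zpowers ω) :
    Set.ncard {σ : Equiv.Perm F | ∀ x y : F, peisertAdj ω x y ↔ peisertAdj ω (σ x) (σ y)}
      = 38880 := by
  have h3 : (3 : F) = 0 := by
    have h : ((Fintype.card F : ℕ) : F) = 0 := Nat.cast_card_eq_zero F
    rw [hF] at h
    have h' : (3 : F) ^ 4 = 0 := by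
      rw [← h]; norm_num
    exact pow_eq_zero_iff (by norm_num) |>.1 h'
  obtain ⟨a, h4, ha⟩ := Peisert81.exists_good_root hF h3 ω hω
  rw [← Peisert81.main_count hF h3 a h4, ← ha]
  congr 1
  ext σ
  simp only [Set.mem_ofPred_eq, Peisert81.IsAut, Peisert81.adj_iff hF ω hω]
end

section
/- Let V = GF(3)⁴ and let Q : V → GF(3) be the hyperbolic quadratic form Q(x₁,x₂,x₃,x₄) = x₁x₂ + x₃x₄. Let Γ be the affine polar graph VO₄⁺(3): vertices V, with x ~ y iff x ≠ y and Q(x − y) = 0. Then the automorphism group of Γ consists exactly of the maps x ↦ g(x) + b where b ∈ V and g ∈ GL(V) is a similarity of Q (i.e., there exists λ ∈ GF(3)* with Q(g(v)) = λ·Q(v) for all v ∈ V); in particular, |Aut(Γ)| = 186624. -/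
/-- The hyperbolic quadratic form `Q(x₁,x₂,x₃,x₄) = x₁x₂ + x₃x₄` on `GF(3)⁴`. -/
def quadFormPlus (v : Fin 4 → ZMod 3) : ZMod 3 :=
  v 0 * v 1 + v 2 * v 3

/-- Adjacency of the affine polar graph `VO₄⁺(3)`: `x ~ y` iff `x ≠ y` and `Q(x - y) = 0`. -/
def voPlusAdj (x y : Fin 4 → ZMod 3) : Prop :=
  x ≠ y ∧ quadFormPlus (x - y) = 0

set_option maxRecDepth 100000

abbrev V4 := ZMod 3 × ZMod 3 × ZMod 3 × ZMod 3
def q4 : V4 → ZMod 3 := fun p => p.1 * p.2.1 + p.2.2.1 * p.2.2.2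
def b4 : V4 → V4 → ZMod 3 := fun p r =>
  p.1 * r.2.1 + p.2.1 * r.1 + p.2.2.1 * r.2.2.2 + p.2.2.2 * r.2.2.1
def I4 : Finset V4 := Finset.univ.filter fun x => q4 x = 0
def J4 (x : V4) : Finset V4 := I4.filter fun y => b4 x y ≠ 0
def W4 (x y : V4) : Finset V4 := I4.filter fun z => b4 x z = 0 ∧ b4 y z = 0
def K4 (x y : V4) : Finset (V4 × V4) :=
  (W4 x y ×ˢ W4 x y).filter fun p => b4 p.1 p.2 = b4 x y

theorem card_I4 : (I4.filter (· ≠ 0)).card = 32 := by decide +kernel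
theorem card_J4 : ∀ x ∈ I4, x ≠ 0 → (J4 x).card = 18 := by decide +kernel
theorem card_K4 : ∀ x ∈ I4, ∀ y ∈ J4 x, (K4 x y).card = 4 := by decide +kernel
theorem sep4 : ∀ x ∈ I4, ∀ z ∈ I4, x ≠ 0 → q4 (x - z) = 0 → z ≠ 0 → z ≠ x → z ≠ -x →
    ∃ w ∈ I4, q4 (w - x) = 0 ∧ q4 (w - z) ≠ 0 := by decide +kernel

/-- The space `GF(3)⁴`. -/
abbrev VV := Fin 4 → ZMod 3

/-- The polar form. -/
def bil (x y : VV) : ZMod 3 := x 0 * y 1 + x 1 * y 0 + x 2 * y 3 + x 3 * y 2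

def toVV (p : V4) : VV := ![p.1, p.2.1, p.2.2.1, p.2.2.2]

def ofVV (v : VV) : V4 := (v 0, v 1, v 2, v 3)

theorem toVV_ofVV (v : VV) : toVV (ofVV v) = v := by
  ext i; fin_cases i <;> rfl

theorem ofVV_toVV (v : V4) : ofVV (toVV v) = v := rfl

theorem q4_ofVV (v : VV) : q4 (ofVV v) = quadFormPlus v := rfl
theorem b4_ofVV (v w : VV) : b4 (ofVV v) (ofVV w) = bil v w := rfl

theorem ofVV_inj {v w : VV} (h : ofVV v = ofVV w) : v = w := by
  rw [← toVV_ofVV v, h, toVV_ofVV]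

theorem mem_I4 (v : V4) : v ∈ I4 ↔ q4 v = 0 := by simp [I4]

theorem sepV (x z : VV) (hx : quadFormPlus x = 0) (hz : quadFormPlus z = 0) (hx0 : x ≠ 0)
    (hxz : quadFormPlus (x - z) = 0) (hz0 : z ≠ 0) (hzx : z ≠ x) (hzx' : z ≠ -x) :
    ∃ w, quadFormPlus w = 0 ∧ quadFormPlus (w - x) = 0 ∧ quadFormPlus (w - z) ≠ 0 := by
  obtain ⟨w, h1, h2, h3⟩ := sep4 (ofVV x) ((mem_I4 _).2 hx) (ofVV z) ((mem_I4 _).2 hz)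
    (fun h => hx0 (ofVV_inj h)) hxz (fun h => hz0 (ofVV_inj h)) (fun h => hzx (ofVV_inj h))
    (fun h => hzx' (ofVV_inj h))
  exact ⟨toVV w, (mem_I4 _).1 h1, h2, h3⟩

theorem z3_neg (a b : VV) : -a - b = b + b - a := by
  have : ∀ u v : ZMod 3, -u - v = v + v - u := by decide
  ext i; exact this _ _

/-- `z` is the third point of the line through `x, y`. -/
def Third (x y z : VV) : Prop :=
  voPlusAdj z x ∧ voPlusAdj z y ∧ ∀ w, voPlusAdj w x → voPlusAdj w y → w = z ∨ voPlusAdj w z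

theorem third_of (x y : VV) (h : voPlusAdj x y) : Third x y (-x - y) := by
  obtain ⟨hne, hq⟩ := h
  have hd : x - y ≠ 0 := sub_ne_zero.2 hne
  refine ⟨⟨?_, ?_⟩, ⟨?_, ?_⟩, ?_⟩
  · rw [z3_neg]
    intro e
    apply hd
    have : ∀ u v : ZMod 3, v + v - u = u → u - v = 0 := by decide
    ext i; exact this _ _ (congrFun e i)
  · rw [z3_neg]; simp only [quadFormPlus, Pi.sub_apply, Pi.add_apply] at *
    linear_combination 4 * hq
  · rw [z3_neg]
    intro e
    apply hd
    have : ∀ u v : ZMod 3, v + v - u = v → u - v = 0 := by decide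
    ext i; exact this _ _ (congrFun e i)
  · rw [z3_neg]; simp only [quadFormPlus, Pi.sub_apply, Pi.add_apply] at *
    linear_combination hq
  · rintro w ⟨-, h1⟩ ⟨-, h2⟩
    by_cases hw : w = -x - y
    · exact Or.inl hw
    · refine Or.inr ⟨hw, ?_⟩
      rw [z3_neg]; simp only [quadFormPlus, Pi.sub_apply, Pi.add_apply] at *
      linear_combination 2 * hq - h1 + 2 * h2

theorem third_unique (x y z : VV) (h : voPlusAdj x y) (ht : Third x y z) : z = -x - y := by
  obtain ⟨hne, hq⟩ := h
  obtain ⟨⟨h1, h1'⟩, ⟨h2, h2'⟩, h3⟩ := ht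
  by_contra hz
  obtain ⟨w, w1, w2, w3⟩ := sepV (x - y) (z - y) hq h2' (sub_ne_zero.2 hne)
    (by simp only [quadFormPlus, Pi.sub_apply] at *; linear_combination h1')
    (sub_ne_zero.2 h2) (fun e => h1 (sub_left_inj.1 e))
    (fun e => hz (by rw [z3_neg, ← sub_add_cancel z y, e]; abel))
  have e1 : w + y - x = w - (x - y) := by abel
  have e2 : w + y - z = w - (z - y) := by abel
  have n1 : w + y ≠ x := by
    intro e
    apply w3; rw [← e2, e]
    simp only [quadFormPlus, Pi.sub_apply] at *; linear_combination h1'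
  have n2 : w + y ≠ y := by
    intro e
    apply w3; rw [← e2, e]
    simp only [quadFormPlus, Pi.sub_apply] at *; linear_combination h2'
  rcases h3 (w + y) ⟨n1, by rw [e1]; exact w2⟩ ⟨n2, by rwa [add_sub_cancel_right]⟩ with h | h
  · apply w3; rw [← e2, h]; simp [quadFormPlus]
  · apply w3; rw [← e2]; exact h.2

theorem line_pres (σ : Equiv.Perm VV) (hσ : ∀ x y, voPlusAdj x y ↔ voPlusAdj (σ x) (σ y))
    (x y : VV) (h : voPlusAdj x y) : σ (-x - y) = -σ x - σ y := by
  obtain ⟨h1, h2, h3⟩ := third_of x y h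
  refine third_unique _ _ _ ((hσ _ _).1 h) ⟨(hσ _ _).1 h1, (hσ _ _).1 h2, ?_⟩
  intro w hw1 hw2
  obtain ⟨w, rfl⟩ := σ.surjective w
  rcases h3 w ((hσ _ _).2 hw1) ((hσ _ _).2 hw2) with h | h
  · exact Or.inl (by rw [h])
  · exact Or.inr ((hσ _ _).1 h)

theorem affine1 (F : ZMod 3 → ZMod 3) (h : F 2 = -F 0 - F 1) (a : ZMod 3) :
    F a = F 0 + a * (F 1 - F 0) := by
  have : ∀ p q r : ZMod 3, r = -p - q → ∀ a : ZMod 3,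
    (if a = 0 then p else if a = 1 then q else r) = p + a * (q - p) := by decide
  rw [← this _ _ _ h a]
  fin_cases a <;> rfl

theorem poly13 (F : ZMod 3 → ZMod 3 → ZMod 3)
    (h1 : ∀ c, F 2 c = -F 0 c - F 1 c) (h2 : ∀ a, F a 2 = -F a 0 - F a 1)
    (h3 : F 2 2 = -F 1 0 - F 0 1) : F 1 1 = F 1 0 + F 0 1 - F 0 0 := by
  have e3 : (3 : ZMod 3) = 0 := by decide
  have a := h1 2
  rw [h3, h2 0, h2 1] at a
  linear_combination -a - (F 1 0 + F 0 1) * e3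

theorem polyF (F : ZMod 3 → ZMod 3 → ZMod 3 → ZMod 3 → ZMod 3)
    (ha : ∀ b c d, F 2 b c d = -F 0 b c d - F 1 b c d)
    (hb : ∀ a c d, F a 2 c d = -F a 0 c d - F a 1 c d)
    (hc : ∀ a b d, F a b 2 d = -F a b 0 d - F a b 1 d)
    (hd : ∀ a b c, F a b c 2 = -F a b c 0 - F a b c 1)
    (h13 : ∀ b d, F 2 b 2 d = -F 1 b 0 d - F 0 b 1 d)
    (h14 : ∀ b c, F 2 b c 2 = -F 1 b c 0 - F 0 b c 1)
    (h23 : ∀ a d, F a 2 2 d = -F a 1 0 d - F a 0 1 d)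
    (h24 : ∀ a c, F a 2 c 2 = -F a 1 c 0 - F a 0 c 1)
    (hl : F 2 2 2 1 = -F 0 0 0 0 - F 1 1 1 2) (h0 : F 0 0 0 0 = 0) (a b c d : ZMod 3) :
    F a b c d = a * F 1 0 0 0 + b * F 0 1 0 0 + c * F 0 0 1 0 + d * F 0 0 0 1 +
      (a * b + c * d) * (F 1 1 0 0 - F 1 0 0 0 - F 0 1 0 0) := by
  have e3 : (3 : ZMod 3) = 0 := by decide
  have g13 : ∀ b d, F 1 b 1 d = F 1 b 0 d + F 0 b 1 d - F 0 b 0 d := fun b d =>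
    poly13 (fun a c => F a b c d) (fun c => ha b c d) (fun a => hc a b d) (h13 b d)
  have g14 : ∀ b c, F 1 b c 1 = F 1 b c 0 + F 0 b c 1 - F 0 b c 0 := fun b c =>
    poly13 (fun a d => F a b c d) (fun d => ha b c d) (fun a => hd a b c) (h14 b c)
  have g23 : ∀ a d, F a 1 1 d = F a 1 0 d + F a 0 1 d - F a 0 0 d := fun a d =>
    poly13 (fun b c => F a b c d) (fun c => hb a c d) (fun b => hc a b d) (h23 a d)
  have g24 : ∀ a c, F a 1 c 1 = F a 1 c 0 + F a 0 c 1 - F a 0 c 0 := fun a c =>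
    poly13 (fun b d => F a b c d) (fun d => hb a c d) (fun b => hd a b c) (h24 a c)
  have la : ∀ a b c d, F a b c d = F 0 b c d + a * (F 1 b c d - F 0 b c d) := fun a b c d =>
    affine1 (fun a => F a b c d) (ha b c d) a
  have lb : ∀ a b c d, F a b c d = F a 0 c d + b * (F a 1 c d - F a 0 c d) := fun a b c d =>
    affine1 (fun b => F a b c d) (hb a c d) b
  have lc : ∀ a b c d, F a b c d = F a b 0 d + c * (F a b 1 d - F a b 0 d) := fun a b c d =>
    affine1 (fun c => F a b c d) (hc a b d) c
  have ld : ∀ a b c d, F a b c d = F a b c 0 + d * (F a b c 1 - F a b c 0) := fun a b c d =>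
    affine1 (fun d => F a b c d) (hd a b c) d
  have key : ∀ a b c d, F a b c d = a * F 1 0 0 0 + b * F 0 1 0 0 + c * F 0 0 1 0 + d * F 0 0 0 1 +
      a * b * (F 1 1 0 0 - F 1 0 0 0 - F 0 1 0 0) + c * d * (F 0 0 1 1 - F 0 0 1 0 - F 0 0 0 1) := by
    intro a b c d
    rw [la a b c d, lb 0 b c d, lb 1 b c d, lc 0 0 c d, lc 0 1 c d, lc 1 0 c d, lc 1 1 c d,
      ld 0 0 0 d, ld 0 0 1 d, ld 0 1 0 d, ld 0 1 1 d, ld 1 0 0 d, ld 1 0 1 d, ld 1 1 0 d,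
      ld 1 1 1 d]
    simp only [g13, g14, g23, g24, h0]
    ring
  have r : F 0 0 1 1 - F 0 0 1 0 - F 0 0 0 1 = F 1 1 0 0 - F 1 0 0 0 - F 0 1 0 0 := by
    rw [key 2 2 2 1, key 1 1 1 2, h0] at hl
    linear_combination hl - (F 1 0 0 0 + F 0 1 0 0 + F 0 0 1 0 + F 0 0 0 1 +
      2 * (F 1 1 0 0 - F 1 0 0 0 - F 0 1 0 0) + (F 0 0 1 1 - F 0 0 1 0 - F 0 0 0 1)) * e3
  rw [key a b c d, r]; ring

theorem formV (f : VV → VV) (H : ∀ x y, voPlusAdj x y → f (-x - y) = -f x - f y)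
    (h0 : f 0 = 0) (v : VV) :
    f v = v 0 • f ![1,0,0,0] + v 1 • f ![0,1,0,0] + v 2 • f ![0,0,1,0] + v 3 • f ![0,0,0,1] +
      quadFormPlus v • (f ![1,1,0,0] - f ![1,0,0,0] - f ![0,1,0,0]) := by
  ext i
  have H' : ∀ x y z : VV, (x ≠ y ∧ quadFormPlus (x - y) = 0) ∧ z = -x - y →
      f z i = - f x i - f y i := by
    rintro x y z ⟨h, rfl⟩
    rw [H x y h]; rfl
  have := polyF (fun a b c d => f ![a, b, c, d] i)
    (fun b c d => H' _ _ _ (by revert b c d; unfold quadFormPlus; decide +kernel))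
    (fun b c d => H' _ _ _ (by revert b c d; unfold quadFormPlus; decide +kernel))
    (fun b c d => H' _ _ _ (by revert b c d; unfold quadFormPlus; decide +kernel))
    (fun b c d => H' _ _ _ (by revert b c d; unfold quadFormPlus; decide +kernel))
    (fun b d => H' _ _ _ (by revert b d; unfold quadFormPlus; decide +kernel))
    (fun b d => H' _ _ _ (by revert b d; unfold quadFormPlus; decide +kernel))
    (fun b d => H' _ _ _ (by revert b d; unfold quadFormPlus; decide +kernel))
    (fun b d => H' _ _ _ (by revert b d; unfold quadFormPlus; decide +kernel))
    (H' _ _ _ (by unfold quadFormPlus; decide +kernel))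
    (by
      have : (![0,0,0,0] : VV) = 0 := by decide
      simp only [this, h0]; rfl) (v 0) (v 1) (v 2) (v 3)
  have hv : ![v 0, v 1, v 2, v 3] = v := toVV_ofVV v
  simp only [hv] at this
  simpa [quadFormPlus] using this

/-- Quadruples of vectors which are similar to the standard basis. -/
def Good (t : Fin 4 → VV) : Prop :=
  (quadFormPlus (t 0) = 0 ∧ quadFormPlus (t 1) = 0 ∧ quadFormPlus (t 2) = 0 ∧
    quadFormPlus (t 3) = 0) ∧
  (bil (t 0) (t 1) ≠ 0 ∧ bil (t 2) (t 3) = bil (t 0) (t 1)) ∧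
  (bil (t 0) (t 2) = 0 ∧ bil (t 0) (t 3) = 0 ∧ bil (t 1) (t 2) = 0 ∧ bil (t 1) (t 3) = 0)

/-- The linear map with prescribed images of the basis. -/
def lin (t : Fin 4 → VV) : VV →ₗ[ZMod 3] VV := Fintype.linearCombination (ZMod 3) t

theorem lin_apply (t : Fin 4 → VV) (v : VV) :
    lin t v = v 0 • t 0 + v 1 • t 1 + v 2 • t 2 + v 3 • t 3 := by
  simp [lin, Fintype.linearCombination_apply, Fin.sum_univ_four]

theorem quad_lin (t : Fin 4 → VV) (v : VV) : quadFormPlus (lin t v) =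
    v 0 ^ 2 * quadFormPlus (t 0) + v 1 ^ 2 * quadFormPlus (t 1) + v 2 ^ 2 * quadFormPlus (t 2) +
    v 3 ^ 2 * quadFormPlus (t 3) + v 0 * v 1 * bil (t 0) (t 1) + v 0 * v 2 * bil (t 0) (t 2) +
    v 0 * v 3 * bil (t 0) (t 3) + v 1 * v 2 * bil (t 1) (t 2) + v 1 * v 3 * bil (t 1) (t 3) +
    v 2 * v 3 * bil (t 2) (t 3) := by
  rw [lin_apply]
  simp only [quadFormPlus, bil, Pi.add_apply, Pi.smul_apply, smul_eq_mul]
  ring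

theorem quad_lin_good (t : Fin 4 → VV) (h : Good t) (v : VV) :
    quadFormPlus (lin t v) = bil (t 0) (t 1) * quadFormPlus v := by
  obtain ⟨⟨h0, h1, h2, h3⟩, ⟨-, k⟩, a, b, c, d⟩ := h
  rw [quad_lin, h0, h1, h2, h3, k, a, b, c, d, quadFormPlus]
  ring

theorem bil_add (x y : VV) : bil x y = quadFormPlus (x + y) - quadFormPlus x - quadFormPlus y := by
  simp only [bil, quadFormPlus, Pi.add_apply]; ring

theorem bil_nondeg (c : VV) (h : ∀ w, bil w c = 0) : c = 0 := by
  ext i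
  fin_cases i
  · simpa [bil] using h ![0,1,0,0]
  · simpa [bil] using h ![1,0,0,0]
  · simpa [bil] using h ![0,0,0,1]
  · simpa [bil] using h ![0,0,1,0]

theorem lin_inj (t : Fin 4 → VV) (h : Good t) : Function.Injective (lin t) := by
  rw [← LinearMap.ker_eq_bot, LinearMap.ker_eq_bot']
  intro v hv
  apply bil_nondeg
  intro w
  have : bil (t 0) (t 1) * bil w v = 0 := by
    rw [bil_add w v, mul_sub, mul_sub, ← quad_lin_good t h, ← quad_lin_good t h, ← quad_lin_good t h,
      map_add, hv]
    simp [quadFormPlus]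
  exact (mul_eq_zero.1 this).resolve_left h.2.1.1

theorem two_ne : (2 : ZMod 3) ≠ 0 := by decide

theorem orth (x c : VV) (h0 : quadFormPlus x = 0) (h1 : quadFormPlus (x + c) = 0)
    (h2 : quadFormPlus (x - c) = 0) : quadFormPlus c = 0 ∧ bil x c = 0 := by
  simp only [bil, quadFormPlus, Pi.add_apply, Pi.sub_apply] at *
  have : 2 * (c 0 * c 1 + c 2 * c 3) = 0 := by linear_combination h1 + h2 - 2 * h0
  have := (mul_eq_zero.1 this).resolve_left two_ne
  exact ⟨this, by linear_combination h1 - h0 - this⟩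

theorem good_of (f : VV → VV) (H : ∀ x y, voPlusAdj x y → f (-x - y) = -f x - f y)
    (h0 : f 0 = 0) (hs : Function.Surjective f)
    (hq : ∀ x y, quadFormPlus (x - y) = 0 → quadFormPlus (f x - f y) = 0) :
    ∃ t, Good t ∧ ∀ v, f v = lin t v := by
  have form := formV f H h0
  set t0 := f ![1,0,0,0] with ht0
  set t1 := f ![0,1,0,0] with ht1
  set t2 := f ![0,0,1,0] with ht2
  set t3 := f ![0,0,0,1] with ht3
  set c := f ![1,1,0,0] - t0 - t1 with hc
  clear_value t0 t1 t2 t3 c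
  have A : ∀ x y z, quadFormPlus (x - y) = 0 → f x - f y = z → quadFormPlus z = 0 := by
    rintro x y z h rfl
    exact hq x y h
  have q0 : quadFormPlus t0 = 0 := A ![1,0,0,0] 0 _ (by decide) (by simp [h0, ht0])
  have q1 : quadFormPlus t1 = 0 := A ![0,1,0,0] 0 _ (by decide) (by simp [h0, ht1])
  have q2 : quadFormPlus t2 = 0 := A ![0,0,1,0] 0 _ (by decide) (by simp [h0, ht2])
  have q3 : quadFormPlus t3 = 0 := A ![0,0,0,1] 0 _ (by decide) (by simp [h0, ht3])
  have o0 := orth t0 c q0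
    (A ![1,1,0,0] ![0,1,0,0] _ (by decide) (by rw [form, form]; simp [quadFormPlus]; try abel))
    (A ![1,-1,0,0] ![0,-1,0,0] _ (by decide) (by rw [form, form]; simp [quadFormPlus]; try abel))
  have o1 := orth t1 c q1
    (A ![1,1,0,0] ![1,0,0,0] _ (by decide) (by rw [form, form]; simp [quadFormPlus]; try abel))
    (A ![-1,1,0,0] ![-1,0,0,0] _ (by decide) (by rw [form, form]; simp [quadFormPlus]; try abel))
  have o2 := orth t2 c q2
    (A ![0,0,1,1] ![0,0,0,1] _ (by decide) (by rw [form, form]; simp [quadFormPlus]; try abel))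
    (A ![0,0,1,-1] ![0,0,0,-1] _ (by decide) (by rw [form, form]; simp [quadFormPlus]; try abel))
  have o3 := orth t3 c q3
    (A ![0,0,1,1] ![0,0,1,0] _ (by decide) (by rw [form, form]; simp [quadFormPlus]; try abel))
    (A ![0,0,-1,1] ![0,0,-1,0] _ (by decide) (by rw [form, form]; simp [quadFormPlus]; try abel))
  have c0 : c = 0 := by
    apply bil_nondeg
    intro w
    obtain ⟨v, rfl⟩ := hs w
    rw [form]
    obtain ⟨k, k0⟩ := o0
    have k1 := o1.2
    have k2 := o2.2
    have k3 := o3.2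
    generalize quadFormPlus v = s
    simp only [bil, quadFormPlus, Pi.add_apply, Pi.smul_apply, smul_eq_mul] at *
    linear_combination v 0 * k0 + v 1 * k1 + v 2 * k2 + v 3 * k3 + 2 * s * k
  have form2 : ∀ v, f v = lin ![t0, t1, t2, t3] v := by
    intro v
    rw [form, c0, lin_apply]; simp
  refine ⟨![t0, t1, t2, t3], ?_, form2⟩
  have B : ∀ x, quadFormPlus x = 0 → quadFormPlus (lin ![t0, t1, t2, t3] x) = 0 := by
    intro x hx
    rw [← form2]
    exact A x 0 _ (by simpa using hx) (by simp [h0])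
  have m02 : bil t0 t2 = 0 := by
    have := B ![1,0,1,0] (by decide)
    rw [quad_lin] at this; simpa [q0, q1, q2, q3] using this
  have m03 : bil t0 t3 = 0 := by
    have := B ![1,0,0,1] (by decide)
    rw [quad_lin] at this; simpa [q0, q1, q2, q3] using this
  have m12 : bil t1 t2 = 0 := by
    have := B ![0,1,1,0] (by decide)
    rw [quad_lin] at this; simpa [q0, q1, q2, q3] using this
  have m13 : bil t1 t3 = 0 := by
    have := B ![0,1,0,1] (by decide)
    rw [quad_lin] at this; simpa [q0, q1, q2, q3] using this
  have m : bil t2 t3 = bil t0 t1 := by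
    have := B ![1,1,1,-1] (by decide)
    rw [quad_lin] at this; simp [q0, q1, q2, q3, m02, m03, m12, m13] at this
    linear_combination -this
  refine ⟨⟨q0, q1, q2, q3⟩, ⟨?_, m⟩, m02, m03, m12, m13⟩
  intro hz
  have hz : bil t0 t1 = 0 := hz
  obtain ⟨v, hv⟩ := hs ![1,1,0,0]
  have e := quad_lin ![t0, t1, t2, t3] v
  rw [← form2, hv] at e
  simp [q0, q1, q2, q3, m02, m03, m12, m13, m, hz] at e
  revert e; decide

theorem aut_form (σ : Equiv.Perm VV) (hσ : ∀ x y, voPlusAdj x y ↔ voPlusAdj (σ x) (σ y)) :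
    ∃ t, Good t ∧ ∀ v, σ v = lin t v + σ 0 := by
  suffices hh : ∃ t, Good t ∧ ∀ v, (fun v => σ v - σ 0) v = lin t v by
    obtain ⟨t, ht, h⟩ := hh
    exact ⟨t, ht, fun v => by rw [← h]; simp⟩
  refine good_of (fun v => σ v - σ 0) ?_ (sub_self _) ?_ ?_
  · intro x y hxy
    have : ∀ a b c : ZMod 3, -a - b - c = -(a - c) - (b - c) := by decide
    simp only [line_pres σ hσ x y hxy]
    ext i; exact this _ _ _
  · intro w
    obtain ⟨v, hv⟩ := σ.surjective (w + σ 0)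
    exact ⟨v, by simp [hv]⟩
  · intro x y h
    simp only [sub_sub_sub_cancel_right]
    by_cases e : x = y
    · subst e; simp [quadFormPlus]
    · exact ((hσ x y).1 ⟨e, h⟩).2

theorem aut_of (σ : Equiv.Perm VV) (g : VV →ₗ[ZMod 3] VV) (b : VV) (l : ZMod 3) (hl : l ≠ 0)
    (hg : ∀ v, quadFormPlus (g v) = l * quadFormPlus v) (h : ∀ v, σ v = g v + b) (x y : VV) :
    voPlusAdj x y ↔ voPlusAdj (σ x) (σ y) := by
  have : σ x - σ y = g (x - y) := by rw [h, h, map_sub]; abel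
  simp only [voPlusAdj, this, hg]
  simp [hl]

theorem card_good : {t : Fin 4 → VV | Good t}.ncard = 2304 := by
  let T : Finset (Σ _ : V4, Σ _ : V4, V4 × V4) :=
    (I4.filter (· ≠ 0)).sigma fun x => (J4 x).sigma fun y => K4 x y
  have hT : T.card = 2304 := by
    simp only [T, Finset.card_sigma]
    rw [Finset.sum_congr rfl (g := fun _ => 72), Finset.sum_const, card_I4]
    · rfl
    · intro x hx
      rw [Finset.mem_filter] at hx
      rw [Finset.sum_congr rfl (g := fun _ => 4), Finset.sum_const, card_J4 x hx.1 hx.2]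
      · rfl
      · intro y hy
        exact card_K4 x hx.1 y hy
  rw [← hT, ← Set.ncard_coe_finset]
  refine Set.ncard_congr (fun t _ => ⟨ofVV (t 0), ofVV (t 1), ofVV (t 2), ofVV (t 3)⟩) ?_ ?_ ?_
  · rintro t ⟨⟨h0, h1, h2, h3⟩, ⟨hn, k⟩, a, b, c, d⟩
    simp only [T, Finset.coe_sigma, Set.mem_sigma_iff, Finset.mem_coe, Finset.mem_filter, J4, K4,
      W4, Finset.mem_product, mem_I4, q4_ofVV, b4_ofVV]
    refine ⟨⟨h0, ?_⟩, ⟨h1, hn⟩, ⟨⟨h2, a, c⟩, ⟨h3, b, d⟩⟩, k⟩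
    intro e
    have : t 0 = 0 := ofVV_inj e
    apply hn; simp [bil, this]
  · intro s t _ _ h
    simp only [Sigma.mk.injEq, heq_eq_eq, Prod.mk.injEq] at h
    obtain ⟨a, b, c, d⟩ := h
    funext i
    fin_cases i
    · exact ofVV_inj a
    · exact ofVV_inj b
    · exact ofVV_inj c
    · exact ofVV_inj d
  · rintro ⟨x, y, z, w⟩ h
    simp only [T, Finset.coe_sigma, Set.mem_sigma_iff, Finset.mem_coe, Finset.mem_filter, J4, K4,
      W4, Finset.mem_product, mem_I4] at h
    obtain ⟨⟨h0, -⟩, ⟨h1, hn⟩, ⟨⟨h2, a, c⟩, ⟨h3, b, d⟩⟩, k⟩ := h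
    exact ⟨![toVV x, toVV y, toVV z, toVV w],
      ⟨⟨h0, h1, h2, h3⟩, ⟨hn, k⟩, a, b, c, d⟩, rfl⟩

theorem lin_ext (s t : Fin 4 → VV) (h : ∀ v, lin s v = lin t v) : s = t := by
  funext i
  have := h (Pi.single i 1)
  simpa [lin] using this

theorem card_aut : Set.ncard {σ : Equiv.Perm VV |
        ∀ x y, voPlusAdj x y ↔ voPlusAdj (σ x) (σ y)} = 186624 := by
  have e : ((Set.univ : Set VV) ×ˢ {t : Fin 4 → VV | Good t}).ncard = 186624 := by
    rw [Set.ncard_prod, card_good, Set.ncard_univ, Nat.card_eq_fintype_card]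
    simp
  rw [← e]
  symm
  have bij : ∀ p : VV × (Fin 4 → VV), Good p.2 →
      Function.Bijective (fun v => lin p.2 v + p.1) := by
    intro p hp
    apply Finite.injective_iff_bijective.1
    intro x y h
    exact lin_inj p.2 hp (add_right_cancel h)
  refine Set.ncard_congr (fun p hp => Equiv.ofBijective _ (bij p hp.2)) ?_ ?_ ?_
  · intro p hp
    exact aut_of _ (lin p.2) p.1 _ hp.2.2.1.1 (quad_lin_good p.2 hp.2) (fun v => rfl)
  · rintro ⟨b, s⟩ ⟨b', t⟩ hp hp' h
    have h' : ∀ v, lin s v + b = lin t v + b' := fun v => congrArg (fun σ => σ v) h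
    have hb : b = b' := by simpa using h' 0
    subst hb
    rw [lin_ext s t fun v => add_right_cancel (h' v)]
  · intro σ hσ
    obtain ⟨t, ht, h⟩ := aut_form σ hσ
    exact ⟨(σ 0, t), ⟨trivial, ht⟩, Equiv.ext fun v => (h v).symm⟩

theorem voPlus3_aut :
    {σ : Equiv.Perm (Fin 4 → ZMod 3) |
        ∀ x y, voPlusAdj x y ↔ voPlusAdj (σ x) (σ y)} =
      {σ : Equiv.Perm (Fin 4 → ZMod 3) |
        ∃ (g : (Fin 4 → ZMod 3) ≃ₗ[ZMod 3] (Fin 4 → ZMod 3)) (b : Fin 4 → ZMod 3)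
          (lam : (ZMod 3)ˣ), (∀ v, quadFormPlus (g v) = (lam : ZMod 3) * quadFormPlus v) ∧
          ∀ v, σ v = g v + b} ∧
    Set.ncard {σ : Equiv.Perm (Fin 4 → ZMod 3) |
        ∀ x y, voPlusAdj x y ↔ voPlusAdj (σ x) (σ y)} = 186624 := by
  refine ⟨?_, card_aut⟩
  ext σ
  constructor
  · intro hσ
    obtain ⟨t, ht, h⟩ := aut_form σ hσ
    exact ⟨LinearEquiv.ofInjectiveEndo (lin t) (lin_inj t ht), σ 0, Units.mk0 _ ht.2.1.1,
      fun v => quad_lin_good t ht v, fun v => h v⟩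
  · rintro ⟨g, b, l, hg, h⟩
    exact aut_of σ g.toLinearMap b l l.ne_zero hg h
end
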